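/- arXiv:2306.15210 — 2 statements merged into one kernel-verified Lean document; each statement's English description precedes it below -/
import Mathlib

section
/- (Gagliardo–Nirenberg inequality for the inhomogeneous Hartree nonlinearity, inverse-square potential case.) Let N ≥ 3, 0 < α < N, λ > −(N−2)²/4, and τ > 0 with min{τ, α, N−α, N−τ, 2−2τ+α} > 0. Let 1 + α/N < p < 1 + (2 − 2τ + α)/(N−2), and set B := Np − N − α + 2τ and A := 2p − B. Then there exists a constant C > 0 such that for every smooth compactly supported u : ℝ^N → ℂ, P[u] ≤ C ‖u‖^A (‖√K_λ u‖²)^{B/2}. -/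
open MeasureTheory

noncomputable def gradNormSq {N : ℕ} (u : EuclideanSpace ℝ (Fin N) → ℂ)
    (x : EuclideanSpace ℝ (Fin N)) : ℝ :=
  ∑ i, ‖fderiv ℝ u x (EuclideanSpace.single i 1)‖ ^ 2

/-- The quantity `‖√K_λ u‖²`. -/
noncomputable def kineticK {N : ℕ} (lam : ℝ) (u : EuclideanSpace ℝ (Fin N) → ℂ) : ℝ :=
  (∫ x, gradNormSq u x) + lam * ∫ x, ‖u x‖ ^ 2 / ‖x‖ ^ 2

/-- The normalizing constant `c_{N,α}` of the Riesz potential. -/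
noncomputable def rieszConst (N : ℕ) (α : ℝ) : ℝ :=
  Real.Gamma (((N : ℝ) - α) / 2) /
    (Real.Gamma (α / 2) * Real.pi ^ ((N : ℝ) / 2) * (2 : ℝ) ^ α)

/-- Convolution `J_α ∗ g` of the Riesz potential with a real-valued function. -/
noncomputable def rieszConvR {N : ℕ} (α : ℝ) (g : EuclideanSpace ℝ (Fin N) → ℝ)
    (x : EuclideanSpace ℝ (Fin N)) : ℝ :=
  ∫ y, rieszConst N α * ‖x - y‖ ^ (α - (N : ℝ)) * g y

/-- The Hartree-type potential energy
`P[u] = ∫ |x|^{-τ} (J_α ∗ (|·|^{-τ}|u|^p))(x) |u(x)|^p dx`. -/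
noncomputable def hartreeP {N : ℕ} (α τ p : ℝ) (u : EuclideanSpace ℝ (Fin N) → ℂ) : ℝ :=
  ∫ x, ‖x‖ ^ (-τ) * rieszConvR α (fun y => ‖y‖ ^ (-τ) * ‖u y‖ ^ p) x * ‖u x‖ ^ p

/-- The `L²` norm. -/
noncomputable def l2norm {N : ℕ} (u : EuclideanSpace ℝ (Fin N) → ℂ) : ℝ :=
  (∫ x, ‖u x‖ ^ 2) ^ ((1 : ℝ) / 2)

open scoped ENNReal

lemma young_bilin {N : ℕ} (f k : EuclideanSpace ℝ (Fin N) → ℝ≥0∞) (hf : Measurable f)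
    (hk : Measurable k) (t : ℝ) (h1 : 1 / 2 < t) (h2 : t < 1) :
    ∫⁻ x, ∫⁻ y, f x * k (x - y) * f y ≤
      (∫⁻ x, f x ^ (1 / t)) ^ (2 * t) * (∫⁻ x, k x ^ (1 / (2 - 2 * t))) ^ (2 - 2 * t) := by
  set a : ℝ := 1 / (2 - 2 * t) with ha
  have ht : 0 < t := by linarith
  have hd : 0 < 2 - 2 * t := by linarith
  let F : Fin 3 → EuclideanSpace ℝ (Fin N) × EuclideanSpace ℝ (Fin N) → ℝ≥0∞ := ![fun z => f z.1 ^ (1 / t) * f z.2 ^ (1 / t),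
    fun z => f z.1 ^ (1 / t) * k (z.1 - z.2) ^ a, fun z => f z.2 ^ (1 / t) * k (z.1 - z.2) ^ a]
  let q : Fin 3 → ℝ := ![2 * t - 1, 1 - t, 1 - t]
  have hm0 : Measurable (F 0) := by
    simp only [F, Matrix.cons_val_zero]; fun_prop
  have hm1 : Measurable (F 1) := by
    simp only [F, Matrix.cons_val_one, Matrix.cons_val_zero]; fun_prop
  have hm2 : Measurable (F 2) := by
    simp only [F, Matrix.cons_val]; fun_prop
  have key := ENNReal.lintegral_prod_norm_pow_le (μ := (volume : Measure (EuclideanSpace ℝ (Fin N))).prod volume)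
    Finset.univ (f := F) (p := q)
    (by intro i _; fin_cases i
        · exact hm0.aemeasurable
        · exact hm1.aemeasurable
        · exact hm2.aemeasurable)
    (by simp [q, Fin.sum_univ_three]; ring)
    (by intro i _; fin_cases i <;> simp [q] <;> linarith)
  have hL : ∫⁻ x, ∫⁻ y, f x * k (x - y) * f y =
      ∫⁻ z, ∏ i, F i z ^ q i ∂((volume : Measure (EuclideanSpace ℝ (Fin N))).prod volume) := by
    rw [lintegral_prod]
    · refine lintegral_congr fun x => lintegral_congr fun y => ?_
      simp only [Fin.prod_univ_three, F, q, Matrix.cons_val]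
      rw [ENNReal.mul_rpow_of_nonneg _ _ (by linarith), ENNReal.mul_rpow_of_nonneg _ _ (by linarith),
        ENNReal.mul_rpow_of_nonneg _ _ (by linarith)]
      simp only [← ENNReal.rpow_mul]
      have e1 : ∀ w : ℝ≥0∞, w ^ (1 / t * (2 * t - 1)) * w ^ (1 / t * (1 - t)) = w := by
        intro w
        rw [← ENNReal.rpow_add_of_nonneg]
        · conv_rhs => rw [← ENNReal.rpow_one w]
          congr 1; field_simp; ring
        · have : 0 ≤ 2 * t - 1 := by linarith
          positivity
        · have : 0 ≤ 1 - t := by linarith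
          positivity
      have e2 : ∀ w : ℝ≥0∞, w ^ (a * (1 - t)) * w ^ (a * (1 - t)) = w := by
        intro w
        have h3 : 0 < 1 - t := by linarith
        rw [← ENNReal.rpow_add_of_nonneg]
        · conv_rhs => rw [← ENNReal.rpow_one w]
          congr 1; rw [ha]; field_simp; ring
        · rw [ha]; positivity
        · rw [ha]; positivity
      calc f x * k (x - y) * f y = (f x ^ (1 / t * (2 * t - 1)) * f x ^ (1 / t * (1 - t))) *
            (k (x - y) ^ (a * (1 - t)) * k (x - y) ^ (a * (1 - t))) *
            (f y ^ (1 / t * (2 * t - 1)) * f y ^ (1 / t * (1 - t))) := by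
            rw [e1, e1, e2]
        _ = _ := by ring
    · refine Measurable.aemeasurable ?_
      refine Finset.measurable_prod _ fun i _ => ?_
      refine Measurable.pow_const ?_ _
      fin_cases i
      · exact hm0
      · exact hm1
      · exact hm2
  have i0 : ∫⁻ z, F 0 z ∂((volume : Measure (EuclideanSpace ℝ (Fin N))).prod volume) =
      (∫⁻ x, f x ^ (1 / t)) * (∫⁻ x, f x ^ (1 / t)) := by
    rw [lintegral_prod _ hm0.aemeasurable]
    simp only [F, Matrix.cons_val_zero]
    simp_rw [lintegral_const_mul _ (hf.pow_const (1 / t))]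
    rw [lintegral_mul_const _ (hf.pow_const (1 / t))]
  have i1 : ∫⁻ z, F 1 z ∂((volume : Measure (EuclideanSpace ℝ (Fin N))).prod volume) =
      (∫⁻ x, f x ^ (1 / t)) * (∫⁻ x, k x ^ a) := by
    rw [lintegral_prod _ hm1.aemeasurable]
    simp only [F, Matrix.cons_val]
    have : ∀ x, ∫⁻ y, f x ^ (1 / t) * k (x - y) ^ a = f x ^ (1 / t) * ∫⁻ x, k x ^ a := by
      intro x
      rw [lintegral_const_mul _ (by fun_prop)]
      rw [lintegral_sub_left_eq_self (fun z => k z ^ a) x]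
    simp_rw [this]
    rw [lintegral_mul_const _ (hf.pow_const (1 / t))]
  have i2 : ∫⁻ z, F 2 z ∂((volume : Measure (EuclideanSpace ℝ (Fin N))).prod volume) =
      (∫⁻ x, f x ^ (1 / t)) * (∫⁻ x, k x ^ a) := by
    rw [lintegral_prod_symm _ hm2.aemeasurable]
    simp only [F, Matrix.cons_val]
    have : ∀ y, ∫⁻ x, f y ^ (1 / t) * k (x - y) ^ a = f y ^ (1 / t) * ∫⁻ x, k x ^ a := by
      intro x
      rw [lintegral_const_mul _ (by fun_prop)]
      rw [lintegral_sub_right_eq_self (fun z => k z ^ a) x]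
    simp_rw [this]
    rw [lintegral_mul_const _ (hf.pow_const (1 / t))]
  rw [hL]
  refine key.trans (le_of_eq ?_)
  rw [Fin.prod_univ_three, i0, i1, i2]
  simp only [q, Matrix.cons_val]
  set X := ∫⁻ x, f x ^ (1 / t)
  set Q := ∫⁻ x, k x ^ a
  rw [ENNReal.mul_rpow_of_nonneg _ _ (by linarith), ENNReal.mul_rpow_of_nonneg _ _ (by linarith)]
  have e3 : X ^ (2 * t) = X ^ (2 * t - 1) * X ^ (2 * t - 1) * X ^ (1 - t) * X ^ (1 - t) := by
    rw [← ENNReal.rpow_add_of_nonneg _ _ (by linarith) (by linarith),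
      ← ENNReal.rpow_add_of_nonneg _ _ (by linarith) (by linarith),
      ← ENNReal.rpow_add_of_nonneg _ _ (by linarith) (by linarith)]
    congr 1; ring
  have e4 : Q ^ (2 - 2 * t) = Q ^ (1 - t) * Q ^ (1 - t) := by
    rw [← ENNReal.rpow_add_of_nonneg _ _ (by linarith) (by linarith)]
    congr 1; ring
  rw [e3, e4]; ring

/-- scaling of truncated power kernels -/
lemma kernel_scale {N : ℕ} (S : Set ℝ) (d : ℝ)
    (hint : Integrable (fun x : EuclideanSpace ℝ (Fin N) => S.indicator (fun r => r ^ d) ‖x‖))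
    (R : ℝ) (hR : 0 < R) :
    ∫⁻ x : EuclideanSpace ℝ (Fin N), ENNReal.ofReal
      (S.indicator (fun r => (R * r) ^ d) (R⁻¹ * ‖x‖)) =
    ENNReal.ofReal (R ^ (N + d) *
      ∫ x : EuclideanSpace ℝ (Fin N), S.indicator (fun r => r ^ d) ‖x‖) := by
  set g : EuclideanSpace ℝ (Fin N) → ℝ := fun x => S.indicator (fun r => r ^ d) ‖x‖ with hg
  have e : ∀ x : EuclideanSpace ℝ (Fin N),
      S.indicator (fun r => (R * r) ^ d) (R⁻¹ * ‖x‖) = R ^ d * g (R⁻¹ • x) := by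
    intro x
    have hn : ‖R⁻¹ • x‖ = R⁻¹ * ‖x‖ := by
      rw [norm_smul, norm_inv, Real.norm_eq_abs, abs_of_pos hR]
    simp only [hg]
    rw [hn]
    simp only [Set.indicator]
    split_ifs
    · rw [Real.mul_rpow hR.le (by positivity)]
    · simp
  have hg0 : ∀ x, 0 ≤ g x := by
    intro x
    simp only [hg, Set.indicator]
    split_ifs <;> positivity
  simp_rw [e]
  rw [← ofReal_integral_eq_lintegral_ofReal]
  · rw [integral_const_mul, Measure.integral_comp_smul]
    simp only [finrank_euclideanSpace, Fintype.card_fin, smul_eq_mul]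
    rw [Real.rpow_add hR, Real.rpow_natCast, abs_of_pos (by positivity)]
    congr 1
    simp
    ring
  · exact ((integrable_comp_smul_iff volume g (by positivity)).2 hint).const_mul _
  · exact Filter.Eventually.of_forall fun x => mul_nonneg (by positivity) (hg0 _)

lemma kernel_near {N : ℕ} (hN : 1 ≤ N) (d : ℝ) (hd : -(N:ℝ) < d) :
    Integrable (fun x : EuclideanSpace ℝ (Fin N) => (Set.Iio 1).indicator (fun r : ℝ => r ^ d) ‖x‖) := by
  have : Nonempty (Fin N) := ⟨⟨0, hN⟩⟩
  rw [integrable_fun_norm_addHaar volume (f := (Set.Iio 1).indicator (fun r : ℝ => r ^ d))]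
  rw [finrank_euclideanSpace, Fintype.card_fin]
  have h1 : IntegrableOn (fun y : ℝ => y ^ ((N:ℝ) - 1 + d)) (Set.Ioo 0 1) := by
    rw [intervalIntegral.integrableOn_Ioo_rpow_iff one_pos]; linarith
  have h2 := h1.integrable_indicator measurableSet_Ioo
  refine (h2.integrableOn (s := Set.Ioi 0)).congr_fun ?_ measurableSet_Ioi
  intro y hy
  have hy : 0 < y := hy
  simp only [Set.indicator, Set.mem_Ioo, hy, true_and, Set.mem_Iio, smul_eq_mul]
  split_ifs
  · rw [Real.rpow_add hy, ← Real.rpow_natCast]; congr 2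
    push_cast [hN]; ring
  · simp

lemma kernel_far {N : ℕ} (hN : 1 ≤ N) (d : ℝ) (hd : d < -(N:ℝ)) :
    Integrable (fun x : EuclideanSpace ℝ (Fin N) => (Set.Ici 1).indicator (fun r : ℝ => r ^ d) ‖x‖) := by
  have : Nonempty (Fin N) := ⟨⟨0, hN⟩⟩
  rw [integrable_fun_norm_addHaar volume (f := (Set.Ici 1).indicator (fun r : ℝ => r ^ d))]
  rw [finrank_euclideanSpace, Fintype.card_fin]
  have h1 : IntegrableOn (fun y : ℝ => y ^ ((N:ℝ) - 1 + d)) (Set.Ici 1) := by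
    rw [integrableOn_Ici_iff_integrableOn_Ioi]
    exact integrableOn_Ioi_rpow_of_lt (by linarith) one_pos
  have h2 := h1.integrable_indicator measurableSet_Ici
  refine (h2.integrableOn (s := Set.Ioi 0)).congr_fun ?_ measurableSet_Ioi
  intro y hy
  have hy : 0 < y := hy
  simp only [Set.indicator, Set.mem_Ici, smul_eq_mul]
  split_ifs
  · rw [Real.rpow_add hy, ← Real.rpow_natCast]; congr 2
    push_cast [hN]; ring
  · simp

lemma fderiv_sq_le {N : ℕ} (u : EuclideanSpace ℝ (Fin N) → ℂ) (x v : EuclideanSpace ℝ (Fin N)) :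
    ‖fderiv ℝ u x v‖ ≤ √(gradNormSq u x) * ‖v‖ := by
  have hv : v = ∑ i, v i • EuclideanSpace.single i (1:ℝ) := by
    ext j; simp [Finset.sum_apply, Pi.single_apply]
  have h1 : ‖fderiv ℝ u x v‖ ≤ ∑ i, ‖fderiv ℝ u x (EuclideanSpace.single i 1)‖ * |v i| := by
    conv_lhs => rw [hv, map_sum]
    refine (norm_sum_le _ _).trans (Finset.sum_le_sum fun i _ => ?_)
    rw [map_smul, norm_smul, Real.norm_eq_abs, mul_comm]
  refine h1.trans ?_
  have := Real.sum_mul_le_sqrt_mul_sqrt Finset.univ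
    (fun i => ‖fderiv ℝ u x (EuclideanSpace.single i 1)‖) (fun i => |v i|)
  rw [EuclideanSpace.norm_eq]
  simpa [gradNormSq] using this

lemma gradNormSq_nonneg {N : ℕ} (u : EuclideanSpace ℝ (Fin N) → ℂ) (x : EuclideanSpace ℝ (Fin N)) :
    0 ≤ gradNormSq u x := Finset.sum_nonneg fun _ _ => by positivity

lemma gradNormSq_cont {N : ℕ} (u : EuclideanSpace ℝ (Fin N) → ℂ) (hu : ContDiff ℝ 1 u) :
    Continuous (gradNormSq u) := by
  have := hu.continuous_fderiv one_ne_zero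
  unfold gradNormSq
  fun_prop

lemma gradNormSq_integrable {N : ℕ} (u : EuclideanSpace ℝ (Fin N) → ℂ) (hu : ContDiff ℝ 1 u)
    (hc : HasCompactSupport u) : Integrable (gradNormSq u) := by
  refine (gradNormSq_cont u hu).integrable_of_hasCompactSupport ?_
  refine (hc.fderiv (𝕜 := ℝ)).mono' ?_
  intro x hx
  by_contra h
  apply hx
  have : fderiv ℝ u x = 0 := image_eq_zero_of_notMem_tsupport h
  simp [gradNormSq, this]

lemma hardy_eps {N : ℕ} (hN : 3 ≤ N) (u : EuclideanSpace ℝ (Fin N) → ℂ) (hu : ContDiff ℝ 1 u)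
    (hc : HasCompactSupport u) (ε : ℝ) (hε : 0 < ε) :
    Integrable (fun x => ‖u x‖ ^ 2 / (‖x‖ ^ 2 + ε)) ∧
    ∫ x, ‖u x‖ ^ 2 / (‖x‖ ^ 2 + ε) ≤ 4 / ((N:ℝ) - 2) ^ 2 * ∫ x, gradNormSq u x := by
  have hN' : (3:ℝ) ≤ N := by exact_mod_cast hN
  let w : EuclideanSpace ℝ (Fin N) → ℝ := fun x => ‖u x‖ ^ 2
  let φ : EuclideanSpace ℝ (Fin N) → ℝ := fun x => (‖x‖ ^ 2 + ε)⁻¹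
  have hpos : ∀ x : EuclideanSpace ℝ (Fin N), 0 < ‖x‖ ^ 2 + ε := fun x => by positivity
  have hw : ContDiff ℝ 1 w := hu.norm_sq ℝ
  have hφ : ContDiff ℝ 1 φ :=
    ((contDiff_norm_sq ℝ).add contDiff_const).inv fun x => (hpos x).ne'
  have hwc : HasCompactSupport w := hc.comp_left (g := fun z : ℂ => ‖z‖ ^ 2) (by simp)
  let V : Fin N → EuclideanSpace ℝ (Fin N) → ℝ := fun i x => x i * φ x
  have hx : ∀ i : Fin N, ContDiff ℝ 1 (fun x : EuclideanSpace ℝ (Fin N) => x i) := fun i =>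
    (EuclideanSpace.proj (𝕜 := ℝ) i).contDiff
  have hV : ∀ i, ContDiff ℝ 1 (V i) := fun i => (hx i).mul hφ
  have cw := hw.continuous
  have cφ := hφ.continuous
  have cdw := hw.continuous_fderiv one_ne_zero
  have hdwc : HasCompactSupport (fderiv ℝ w) := hwc.fderiv (𝕜 := ℝ)
  have int1 : ∀ i, Integrable (fun x => fderiv ℝ w x (EuclideanSpace.single i 1) * V i x) := by
    intro i
    have := (hV i).continuous
    refine Continuous.integrable_of_hasCompactSupport (by fun_prop) ?_
    refine HasCompactSupport.mul_right ?_
    exact hdwc.comp_left (g := fun L : EuclideanSpace ℝ (Fin N) →L[ℝ] ℝ => L (EuclideanSpace.single i 1)) (by simp)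
  have int2 : ∀ i, Integrable (fun x => w x * fderiv ℝ (V i) x (EuclideanSpace.single i 1)) := by
    intro i
    have := (hV i).continuous_fderiv one_ne_zero
    exact Continuous.integrable_of_hasCompactSupport (by fun_prop) hwc.mul_right
  have int3 : ∀ i, Integrable (fun x => w x * V i x) := by
    intro i
    have := (hV i).continuous
    exact Continuous.integrable_of_hasCompactSupport (by fun_prop) hwc.mul_right
  have ibp : ∀ i, ∫ x, w x * fderiv ℝ (V i) x (EuclideanSpace.single i 1) =
      - ∫ x, fderiv ℝ w x (EuclideanSpace.single i 1) * V i x := fun i =>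
    integral_mul_fderiv_eq_neg_fderiv_mul_of_integrable (int1 i) (int2 i) (int3 i)
      (fun x _ => hw.differentiable one_ne_zero x) (fun x _ => (hV i).differentiable one_ne_zero x)
  have sum0 : ∫ x, (∑ i, (w x * fderiv ℝ (V i) x (EuclideanSpace.single i 1) +
      fderiv ℝ w x (EuclideanSpace.single i 1) * V i x)) = 0 := by
    rw [integral_finsetSum _ (fun i _ => by exact (int2 i).add (int1 i))]
    refine Finset.sum_eq_zero fun i _ => ?_
    rw [integral_add (int2 i) (int1 i), ibp i]; ring
  have dw : ∀ x v, fderiv ℝ w x v = 2 * inner ℝ (u x) (fderiv ℝ u x v) := by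
    intro x v
    have := ((hu.differentiable one_ne_zero x).hasFDerivAt.norm_sq).fderiv
    change fderiv ℝ (fun x => ‖u x‖ ^ 2) x v = _
    rw [this]; simp; ring
  have dφ : ∀ x v, fderiv ℝ φ x v = - (2 * inner ℝ x v) * φ x ^ 2 := by
    intro x v
    have h1 : HasFDerivAt (fun x : EuclideanSpace ℝ (Fin N) => ‖x‖ ^ 2 + ε) (2 • (innerSL ℝ x)) x := by
      simpa using ((hasFDerivAt_id x).norm_sq).add_const ε
    have h2 := (hasDerivAt_inv (hpos x).ne').comp_hasFDerivAt x h1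
    have h3 : fderiv ℝ φ x = _ := h2.fderiv
    rw [h3]; simp [φ]; ring
  have dV : ∀ i x, fderiv ℝ (V i) x (EuclideanSpace.single i 1) =
      φ x - 2 * (x i) ^ 2 * φ x ^ 2 := by
    intro i x
    have h1 : HasFDerivAt (fun x : EuclideanSpace ℝ (Fin N) => x i)
      (EuclideanSpace.proj (𝕜 := ℝ) i : EuclideanSpace ℝ (Fin N) →L[ℝ] ℝ) x :=
      (EuclideanSpace.proj (𝕜 := ℝ) i : EuclideanSpace ℝ (Fin N) →L[ℝ] ℝ).hasFDerivAt
    have h2 := h1.mul (hφ.differentiable one_ne_zero x).hasFDerivAt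
    have h3 : fderiv ℝ (V i) x = _ := h2.fderiv
    rw [h3]
    simp [dφ, EuclideanSpace.inner_single_right]
    ring
  have intX : Integrable (fun x => ‖u x‖ ^ 2 / (‖x‖ ^ 2 + ε)) := by
    refine Continuous.integrable_of_hasCompactSupport (f := fun x => w x * φ x) (by fun_prop) hwc.mul_right
  refine ⟨intX, ?_⟩
  have intG := gradNormSq_integrable u hu hc
  set c : ℝ := ((N:ℝ) - 2) / 2 with hcdef
  have hcpos : 0 < c := by rw [hcdef]; linarith
  have pt : ∀ x, c * (‖u x‖ ^ 2 / (‖x‖ ^ 2 + ε)) - c⁻¹ * gradNormSq u x ≤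
      (∑ i, (w x * fderiv ℝ (V i) x (EuclideanSpace.single i 1) +
      fderiv ℝ w x (EuclideanSpace.single i 1) * V i x)) := by
    intro x
    have hxs : ∑ i, (x i) ^ 2 = ‖x‖ ^ 2 := by
      rw [EuclideanSpace.norm_sq_eq]; simp
    have e1 : ∑ i, w x * fderiv ℝ (V i) x (EuclideanSpace.single i 1) =
        w x * (N * φ x - 2 * ‖x‖ ^ 2 * φ x ^ 2) := by
      simp_rw [dV, ← Finset.mul_sum, Finset.sum_sub_distrib, ← Finset.sum_mul, ← Finset.mul_sum, hxs]
      simp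
    have e2 : ∑ i, fderiv ℝ w x (EuclideanSpace.single i 1) * V i x = φ x * fderiv ℝ w x x := by
      have hv : x = ∑ i, x i • EuclideanSpace.single i (1:ℝ) := by
        ext j; simp [Finset.sum_apply, Pi.single_apply]
      have h0 : fderiv ℝ w x x = ∑ i, fderiv ℝ w x (x i • EuclideanSpace.single i (1:ℝ)) := by
        rw [← map_sum, ← hv]
      rw [h0, Finset.mul_sum]
      refine Finset.sum_congr rfl fun i _ => ?_
      rw [map_smul]; simp [V]; ring
    rw [Finset.sum_add_distrib, e1, e2, dw]
    set b := ‖u x‖ with hb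
    set g := √(gradNormSq u x) with hg
    have hg2 : gradNormSq u x = g ^ 2 := (Real.sq_sqrt (gradNormSq_nonneg u x)).symm
    have hin : -(b * (g * ‖x‖)) ≤ inner ℝ (u x) (fderiv ℝ u x x) := by
      have h1 := abs_real_inner_le_norm (u x) (fderiv ℝ u x x)
      have h2 := neg_le_of_abs_le h1
      have h3 := fderiv_sq_le u x x
      have h4 := mul_le_mul_of_nonneg_left h3 (norm_nonneg (u x))
      linarith
    have hφp : 0 < φ x := inv_pos.2 (hpos x)
    have hφ1 : ‖x‖ ^ 2 * φ x ≤ 1 := by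
      simp only [φ]; rw [← div_eq_mul_inv, div_le_one (hpos x)]; linarith
    have hNc : (N:ℝ) = 2 * c + 2 := by rw [hcdef]; ring
    rw [hg2, div_eq_mul_inv, hNc]
    change c * (b ^ 2 * φ x) - c⁻¹ * g ^ 2 ≤ b ^ 2 * ((2 * c + 2) * φ x - 2 * ‖x‖ ^ 2 * φ x ^ 2) + φ x * (2 * _)
    have h5 := mul_le_mul_of_nonneg_left hin hφp.le
    set I := inner ℝ (u x) (fderiv ℝ u x x)
    set r := ‖x‖
    set f := φ x
    have h6 : 0 ≤ c⁻¹ * (c * (b * r * f) - g) ^ 2 := by positivity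
    have h7 : c⁻¹ * (c * (b * r * f) - g) ^ 2 = c * (b * r * f) ^ 2 - 2 * (b * r * f) * g + c⁻¹ * g ^ 2 := by
      field_simp; ring
    have h8 : 0 ≤ b ^ 2 * f * (1 - r ^ 2 * f) * (c + 2) := by
      have : 0 ≤ 1 - r ^ 2 * f := by linarith
      positivity
    nlinarith
  have hmono := integral_mono ((intX.const_mul c).sub (intG.const_mul c⁻¹))
    (integrable_finsetSum _ (fun i _ => (int2 i).add (int1 i))) pt
  rw [show (∫ x, ∑ i, ((fun x => w x * fderiv ℝ (V i) x (EuclideanSpace.single i 1)) + 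
      fun x => fderiv ℝ w x (EuclideanSpace.single i 1) * V i x) x) = 0 from sum0] at hmono
  simp only [Pi.sub_apply] at hmono
  rw [integral_sub (intX.const_mul c) (intG.const_mul c⁻¹), integral_const_mul, integral_const_mul] at hmono
  have : (N:ℝ) - 2 = 2 * c := by rw [hcdef]; ring
  rw [this]
  have h9 : 4 / (2 * c) ^ 2 * ∫ x, gradNormSq u x = c⁻¹ * (c⁻¹ * ∫ x, gradNormSq u x) := by
    field_simp; norm_num
  rw [h9, ← div_eq_inv_mul, le_div_iff₀ hcpos]
  linarith

lemma hardy {N : ℕ} (hN : 3 ≤ N) (u : EuclideanSpace ℝ (Fin N) → ℂ) (hu : ContDiff ℝ 1 u)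
    (hc : HasCompactSupport u) :
    ∫⁻ x, ENNReal.ofReal (‖u x‖ ^ 2 / ‖x‖ ^ 2) ≤
      ENNReal.ofReal (4 / ((N:ℝ) - 2) ^ 2 * ∫ x, gradNormSq u x) := by
  have cu := hu.continuous
  have hm : ∀ n : ℕ, Measurable fun x => ENNReal.ofReal (‖u x‖ ^ 2 / (‖x‖ ^ 2 + 1 / ((n:ℝ) + 1))) := by
    intro n
    have := cu.measurable
    fun_prop
  have hpt : ∀ x, ENNReal.ofReal (‖u x‖ ^ 2 / ‖x‖ ^ 2) ≤
      Filter.liminf (fun n : ℕ => ENNReal.ofReal (‖u x‖ ^ 2 / (‖x‖ ^ 2 + 1 / ((n:ℝ) + 1)))) Filter.atTop := by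
    intro x
    by_cases h : x = 0
    · simp [h]
    · have hx : ‖x‖ ^ 2 ≠ 0 := by positivity
      have h1 : Filter.Tendsto (fun n : ℕ => ‖x‖ ^ 2 + 1 / ((n:ℝ) + 1)) Filter.atTop (nhds (‖x‖ ^ 2)) := by
        simpa using tendsto_one_div_add_atTop_nhds_zero_nat.const_add (‖x‖ ^ 2)
      have h2 := ENNReal.tendsto_ofReal ((tendsto_const_nhds (x := ‖u x‖ ^ 2)).div h1 hx)
      exact h2.liminf_eq.ge
  refine (lintegral_mono hpt).trans ((lintegral_liminf_le hm).trans ?_)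
  refine Filter.liminf_le_of_le (by isBoundedDefault) fun b hb => ?_
  obtain ⟨n, hn⟩ := hb.exists
  refine hn.trans ?_
  have hp : 0 < 1 / ((n:ℝ) + 1) := by positivity
  obtain ⟨h1, h2⟩ := hardy_eps hN u hu hc _ hp
  rw [← ofReal_integral_eq_lintegral_ofReal h1 (Filter.Eventually.of_forall fun x => by positivity)]
  exact ENNReal.ofReal_le_ofReal h2


lemma sobolev_bound (N : ℕ) (hN : 3 ≤ N) : ∃ C : ℝ, 0 ≤ C ∧
    ∀ u : EuclideanSpace ℝ (Fin N) → ℂ, ContDiff ℝ 1 u → HasCompactSupport u →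
    ∫⁻ x, ENNReal.ofReal (‖u x‖ ^ (2 * (N:ℝ) / (N - 2))) ≤
      ENNReal.ofReal (C * (∫ x, gradNormSq u x) ^ ((N:ℝ) / (N - 2))) := by
  have hN' : (3:ℝ) ≤ N := by exact_mod_cast hN
  have hN2 : (0:ℝ) < N - 2 := by linarith
  set q : ℝ := 2 * (N:ℝ) / (N - 2) with hq
  have hq0 : 0 < q := by rw [hq]; positivity
  set c := SNormLESNormFDerivOfEqConst ℂ (volume : Measure (EuclideanSpace ℝ (Fin N))) 2
  refine ⟨(c:ℝ) ^ q, by positivity, fun u hu hc => ?_⟩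
  have key := eLpNorm_le_eLpNorm_fderiv_of_eq (μ := (volume : Measure (EuclideanSpace ℝ (Fin N))))
    hu hc (p := 2) (p' := q.toNNReal) (by norm_num)
    (by rw [finrank_euclideanSpace, Fintype.card_fin]; omega)
    (by
      rw [finrank_euclideanSpace, Fintype.card_fin]
      rw [Real.coe_toNNReal q hq0.le, hq]
      push_cast
      field_simp)
  have e2 : eLpNorm (fderiv ℝ u) ((2 : NNReal) : ℝ≥0∞) volume ≤
      ENNReal.ofReal (∫ x, gradNormSq u x) ^ ((1:ℝ) / 2) := by
    rw [eLpNorm_eq_lintegral_rpow_enorm_toReal (by simp) (by simp)]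
    simp only [ENNReal.coe_toReal, NNReal.coe_ofNat]
    refine ENNReal.rpow_le_rpow ?_ (by norm_num)
    rw [ofReal_integral_eq_lintegral_ofReal (gradNormSq_integrable u hu hc)
      (Filter.Eventually.of_forall (gradNormSq_nonneg u))]
    refine lintegral_mono fun x => ?_
    have h1 : ‖fderiv ℝ u x‖ ≤ √(gradNormSq u x) :=
      ContinuousLinearMap.opNorm_le_bound _ (Real.sqrt_nonneg _) (fderiv_sq_le u x)
    have h2 : ‖fderiv ℝ u x‖ ^ 2 ≤ gradNormSq u x := by
      have := pow_le_pow_left₀ (norm_nonneg _) h1 2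
      rwa [Real.sq_sqrt (gradNormSq_nonneg u x)] at this
    rw [← ofReal_norm, ENNReal.ofReal_rpow_of_nonneg (norm_nonneg _) (by norm_num)]
    refine ENNReal.ofReal_le_ofReal ?_
    rw [Real.rpow_two]; exact h2
  have e1 : ∫⁻ x, ENNReal.ofReal (‖u x‖ ^ q) =
      (eLpNorm u (q.toNNReal : ℝ≥0∞) volume) ^ q := by
    rw [eLpNorm_eq_lintegral_rpow_enorm_toReal
      (by simpa using hq0) (by simp)]
    simp only [ENNReal.coe_toReal, Real.coe_toNNReal q hq0.le]
    rw [← ENNReal.rpow_mul, one_div, inv_mul_cancel₀ hq0.ne', ENNReal.rpow_one]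
    refine lintegral_congr fun x => ?_
    rw [← ofReal_norm, ENNReal.ofReal_rpow_of_nonneg (norm_nonneg _) hq0.le]
  have hG : 0 ≤ ∫ x, gradNormSq u x := integral_nonneg (gradNormSq_nonneg u)
  rw [e1]
  refine (ENNReal.rpow_le_rpow (key.trans (mul_le_mul_right e2 _)) hq0.le).trans (le_of_eq ?_)
  rw [ENNReal.mul_rpow_of_nonneg _ _ hq0.le, ← ENNReal.rpow_mul,
    ENNReal.ofReal_mul (by positivity), ← ENNReal.ofReal_rpow_of_nonneg hG (by positivity),
    ← ENNReal.ofReal_rpow_of_nonneg (by positivity) hq0.le, ENNReal.ofReal_coe_nnreal]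
  congr 2
  rw [hq]; field_simp

lemma kinetic_bound (N : ℕ) (hN : 3 ≤ N) (lam : ℝ) (hlam : -(((N : ℝ) - 2) ^ 2 / 4) < lam) :
    ∃ C : ℝ, 0 < C ∧
    ∀ u : EuclideanSpace ℝ (Fin N) → ℂ, ContDiff ℝ 1 u → HasCompactSupport u →
    ∫ x, gradNormSq u x ≤ C * kineticK lam u := by
  have hN' : (3:ℝ) ≤ N := by exact_mod_cast hN
  have hN2 : (0:ℝ) < (N - 2) ^ 2 := by
    have : (0:ℝ) < N - 2 := by linarith
    positivity
  set D : ℝ := 4 / ((N:ℝ) - 2) ^ 2 with hD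
  have hD0 : 0 < D := by positivity
  have hDl : 0 < 1 + lam * D := by
    have : -1 < lam * D := by
      rw [hD, ← mul_div_assoc, lt_div_iff₀ hN2]; linarith
    linarith
  have hfin : ∀ u : EuclideanSpace ℝ (Fin N) → ℂ, ContDiff ℝ 1 u → HasCompactSupport u →
      ∫ x, ‖u x‖ ^ 2 / ‖x‖ ^ 2 ≤ D * ∫ x, gradNormSq u x := by
    intro u hu hc
    have cu := hu.continuous.measurable
    rw [integral_eq_lintegral_of_nonneg_ae (Filter.Eventually.of_forall fun x => by positivity)
      (Measurable.aestronglyMeasurable (by fun_prop))]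
    refine ENNReal.toReal_le_of_le_ofReal ?_ (hardy hN u hu hc)
    exact mul_nonneg hD0.le (integral_nonneg (gradNormSq_nonneg u))
  rcases le_or_gt 0 lam with h | h
  · refine ⟨1, one_pos, fun u hu hc => ?_⟩
    have : 0 ≤ ∫ x, ‖u x‖ ^ 2 / ‖x‖ ^ 2 := integral_nonneg fun x => by positivity
    unfold kineticK
    nlinarith
  · refine ⟨(1 + lam * D)⁻¹, by positivity, fun u hu hc => ?_⟩
    rw [← div_eq_inv_mul, le_div_iff₀ hDl]
    have := hfin u hu hc
    unfold kineticK
    nlinarith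

lemma holder_three {X : Type*} [MeasurableSpace X] (μ : Measure X) (a b c : X → ℝ≥0∞)
    (ha : Measurable a) (hb : Measurable b) (hc : Measurable c) (i j k : ℝ)
    (hi : 0 ≤ i) (hj : 0 ≤ j) (hk : 0 ≤ k) (h : i + j + k = 1) :
    ∫⁻ x, a x ^ i * b x ^ j * c x ^ k ∂μ ≤
      (∫⁻ x, a x ∂μ) ^ i * (∫⁻ x, b x ∂μ) ^ j * (∫⁻ x, c x ∂μ) ^ k := by
  have key := ENNReal.lintegral_prod_norm_pow_le (μ := μ)
    Finset.univ (f := ![a, b, c]) (p := ![i, j, k])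
    (by intro l _; fin_cases l
        · exact ha.aemeasurable
        · exact hb.aemeasurable
        · exact hc.aemeasurable)
    (by simp [Fin.sum_univ_three, h])
    (by intro l _; fin_cases l <;> simp [hi, hj, hk])
  simpa [Fin.prod_univ_three] using key

lemma f_bound (N : ℕ) (hN : 3 ≤ N) (lam τ p t : ℝ) (hlam : -(((N : ℝ) - 2) ^ 2 / 4) < lam)
    (hτ : 0 < τ) (hp : 0 < p) (ht : 0 < t) (htp : 2 * t < p)
    (htL : τ / N + p * (N - 2) / (2 * N) < t) :
    ∃ C : ℝ, 0 ≤ C ∧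
    ∀ u : EuclideanSpace ℝ (Fin N) → ℂ, ContDiff ℝ 1 u → HasCompactSupport u →
    (∫⁻ x, ENNReal.ofReal (‖x‖ ^ (-τ) * ‖u x‖ ^ p) ^ (1 / t)) ^ (2 * t) ≤
      ENNReal.ofReal (C * (kineticK lam u ^ (τ + N * p / 2 - N * t) *
        (∫ x, ‖u x‖ ^ 2) ^ (p - (τ + N * p / 2 - N * t)))) := by
  have hN' : (3:ℝ) ≤ N := by exact_mod_cast hN
  have hN2 : (0:ℝ) < N - 2 := by linarith
  have hN0 : (0:ℝ) < N := by linarith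
  obtain ⟨c1, hc1, H1⟩ := kinetic_bound N hN lam hlam
  obtain ⟨c2, hc2, H2⟩ := sobolev_bound N hN
  set D : ℝ := 4 / ((N:ℝ) - 2) ^ 2 with hD
  have hD0 : 0 < D := by positivity
  set i : ℝ := τ / (2 * t) with hi
  set k : ℝ := (p / t - 2) * (N - 2) / 4 with hk
  set j : ℝ := 1 - i - k with hj
  have hi0 : 0 < i := by positivity
  have hk0 : 0 < k := by
    have : 0 < p / t - 2 := by rw [sub_pos, lt_div_iff₀ ht]; linarith
    positivity
  have hj0 : 0 < j := by
    have e : j = (t - (τ / N + p * (N - 2) / (2 * N))) * (N / (2 * t)) := by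
      rw [hj, hi, hk]; field_simp; ring
    rw [e]
    have : 0 < t - (τ / N + p * (N - 2) / (2 * N)) := by linarith
    positivity
  have hs : i + j + k = 1 := by rw [hj]; ring
  set q : ℝ := 2 * (N:ℝ) / (N - 2) with hq
  set c3 : ℝ := (D * c1) ^ i * (c2 * c1 ^ ((N:ℝ) / (N - 2))) ^ k with hc3
  refine ⟨c3 ^ (2 * t), by positivity, fun u hu hc => ?_⟩
  have cu := hu.continuous
  have mu := cu.measurable
  have hG : 0 ≤ ∫ x, gradNormSq u x := integral_nonneg (gradNormSq_nonneg u)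
  have hGK := H1 u hu hc
  set G := ∫ x, gradNormSq u x
  set K := kineticK lam u
  have hK : 0 ≤ K := by
    by_contra hneg
    push Not at hneg
    nlinarith [mul_neg_of_pos_of_neg hc1 hneg]
  have hM : 0 ≤ ∫ x, ‖u x‖ ^ 2 := integral_nonneg fun x => by positivity
  have hMe : ∫⁻ x, ENNReal.ofReal (‖u x‖ ^ 2) = ENNReal.ofReal (∫ x, ‖u x‖ ^ 2) := by
    rw [ofReal_integral_eq_lintegral_ofReal _ (Filter.Eventually.of_forall fun x => by positivity)]
    refine Continuous.integrable_of_hasCompactSupport (by fun_prop) ?_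
    exact hc.comp_left (g := fun z : ℂ => ‖z‖ ^ 2) (by simp)
  set M := ∫ x, ‖u x‖ ^ 2
  have hpt : ∀ x, ENNReal.ofReal (‖x‖ ^ (-τ) * ‖u x‖ ^ p) ^ (1 / t) =
      ENNReal.ofReal (‖u x‖ ^ 2 / ‖x‖ ^ 2) ^ i * ENNReal.ofReal (‖u x‖ ^ 2) ^ j *
        ENNReal.ofReal (‖u x‖ ^ q) ^ k := by
    intro x
    rw [ENNReal.ofReal_rpow_of_nonneg (by positivity) (by positivity),
      ENNReal.ofReal_rpow_of_nonneg (by positivity) hi0.le,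
      ENNReal.ofReal_rpow_of_nonneg (by positivity) hj0.le,
      ENNReal.ofReal_rpow_of_nonneg (by positivity) hk0.le,
      ← ENNReal.ofReal_mul (by positivity), ← ENNReal.ofReal_mul (by positivity)]
    congr 1
    by_cases hx : ‖x‖ = 0
    · rw [hx, Real.zero_rpow (by linarith)]
      simp [Real.zero_rpow hi0.ne', Real.zero_rpow (inv_pos.2 ht).ne']
    by_cases hux : ‖u x‖ = 0
    · rw [hux, Real.zero_rpow hp.ne']
      simp [Real.zero_rpow hi0.ne', Real.zero_rpow (inv_pos.2 ht).ne']
    have hx' : 0 < ‖x‖ := lt_of_le_of_ne (norm_nonneg _) (Ne.symm hx)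
    have hu' : 0 < ‖u x‖ := lt_of_le_of_ne (norm_nonneg _) (Ne.symm hux)
    rw [Real.mul_rpow (by positivity) (by positivity), Real.div_rpow (by positivity) (by positivity)]
    simp only [← Real.rpow_two]
    simp only [← Real.rpow_mul hx'.le, ← Real.rpow_mul hu'.le]
    rw [div_eq_mul_inv (‖u x‖ ^ (2 * i)), ← Real.rpow_neg hx'.le]
    have e1 : -τ * (1 / t) = -(2 * i) := by rw [hi]; field_simp
    have e2 : p * (1 / t) = 2 * i + 2 * j + q * k := by
      rw [hj, hk, hq]; field_simp; ring
    rw [e1, e2, Real.rpow_add hu', Real.rpow_add hu']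
    ring
  have b1 : ∫⁻ x, ENNReal.ofReal (‖x‖ ^ (-τ) * ‖u x‖ ^ p) ^ (1 / t) ≤
      ENNReal.ofReal (c3 * (K ^ (i + (N:ℝ) / (N - 2) * k) * M ^ j)) := by
    simp_rw [hpt]
    refine (holder_three volume _ _ _ (by fun_prop) (by fun_prop) (by fun_prop) i j k
      hi0.le hj0.le hk0.le hs).trans ?_
    have h1 : ∫⁻ x, ENNReal.ofReal (‖u x‖ ^ 2 / ‖x‖ ^ 2) ≤ ENNReal.ofReal (D * c1 * K) := by
      refine (hardy hN u hu hc).trans (ENNReal.ofReal_le_ofReal ?_)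
      rw [mul_assoc]
      exact mul_le_mul_of_nonneg_left hGK hD0.le
    have h2 : ∫⁻ x, ENNReal.ofReal (‖u x‖ ^ q) ≤
        ENNReal.ofReal (c2 * c1 ^ ((N:ℝ) / (N - 2)) * K ^ ((N:ℝ) / (N - 2))) := by
      refine (H2 u hu hc).trans (ENNReal.ofReal_le_ofReal ?_)
      rw [mul_assoc, ← Real.mul_rpow hc1.le hK]
      exact mul_le_mul_of_nonneg_left (Real.rpow_le_rpow hG hGK (by positivity)) hc2
    rw [hMe]
    refine (mul_le_mul' (mul_le_mul' (ENNReal.rpow_le_rpow h1 hi0.le) le_rfl)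
      (ENNReal.rpow_le_rpow h2 hk0.le)).trans (le_of_eq ?_)
    rw [ENNReal.ofReal_rpow_of_nonneg (by positivity) hi0.le,
      ENNReal.ofReal_rpow_of_nonneg (by positivity) hj0.le,
      ENNReal.ofReal_rpow_of_nonneg (by positivity) hk0.le,
      ← ENNReal.ofReal_mul (by positivity), ← ENNReal.ofReal_mul (by positivity)]
    congr 1
    rw [Real.mul_rpow (x := D * c1) (by positivity) hK,
      Real.mul_rpow (x := c2 * c1 ^ ((N:ℝ) / (N - 2))) (by positivity) (by positivity),
      ← Real.rpow_mul hK, Real.rpow_add_of_nonneg hK hi0.le (by positivity), hc3]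
    ring
  refine (ENNReal.rpow_le_rpow b1 (by positivity)).trans (le_of_eq ?_)
  rw [ENNReal.ofReal_rpow_of_nonneg (by positivity) (by positivity)]
  congr 1
  rw [Real.mul_rpow (x := c3) (by positivity) (by positivity),
    Real.mul_rpow (x := K ^ (i + (N:ℝ) / (N - 2) * k)) (by positivity) (by positivity),
    ← Real.rpow_mul hK, ← Real.rpow_mul hM]
  have e1 : (i + (N:ℝ) / (N - 2) * k) * (2 * t) = τ + N * p / 2 - N * t := by
    rw [hi, hk]; field_simp; ring
  have e2 : j * (2 * t) = p - (τ + N * p / 2 - N * t) := by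
    rw [hj, hi, hk]; field_simp; ring
  rw [e1, e2]

/-- Truncated Riesz kernel. -/
noncomputable def truncKernel {N : ℕ} (α R : ℝ) (S : Set ℝ) (z : EuclideanSpace ℝ (Fin N)) : ℝ≥0∞ :=
  ENNReal.ofReal (S.indicator (fun r => (R * r) ^ (α - (N:ℝ))) (R⁻¹ * ‖z‖))

lemma truncKernel_measurable {N : ℕ} (α R : ℝ) (S : Set ℝ) (hS : MeasurableSet S) :
    Measurable (truncKernel (N := N) α R S) := by
  unfold truncKernel
  refine ENNReal.measurable_ofReal.comp ?_
  refine Measurable.comp (g := S.indicator (fun r => (R * r) ^ (α - (N:ℝ)))) ?_ (by fun_prop)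
  exact Measurable.indicator (by fun_prop) hS

lemma term_bound (N : ℕ) (hN : 3 ≤ N) (lam τ p t α : ℝ) (hlam : -(((N : ℝ) - 2) ^ 2 / 4) < lam)
    (hτ : 0 < τ) (hp : 0 < p) (ht : 1 / 2 < t) (ht1 : t < 1) (htp : 2 * t < p)
    (htL : τ / N + p * (N - 2) / (2 * N) < t) (S : Set ℝ) (hS : MeasurableSet S)
    (hint : Integrable (fun x : EuclideanSpace ℝ (Fin N) =>
      S.indicator (fun r => r ^ ((α - N) / (2 - 2 * t))) ‖x‖)) :
    ∃ C : ℝ, 0 ≤ C ∧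
    ∀ u : EuclideanSpace ℝ (Fin N) → ℂ, ContDiff ℝ 1 u → HasCompactSupport u →
    ∀ R : ℝ, 0 < R →
    ∫⁻ x, ∫⁻ y, ENNReal.ofReal (‖x‖ ^ (-τ) * ‖u x‖ ^ p) * truncKernel α R S (x - y) *
      ENNReal.ofReal (‖y‖ ^ (-τ) * ‖u y‖ ^ p) ≤
      ENNReal.ofReal (C * (R ^ (N + α - 2 * N * t) * kineticK lam u ^ (τ + N * p / 2 - N * t) *
        (∫ x, ‖u x‖ ^ 2) ^ (p - (τ + N * p / 2 - N * t)))) := by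
  have ht0 : 0 < t := by linarith
  have hd0 : 0 < 2 - 2 * t := by linarith
  obtain ⟨C1, hC1, H1⟩ := f_bound N hN lam τ p t hlam hτ hp ht0 htp htL
  set d := (α - N) / (2 - 2 * t) with hd
  set I := ∫ x : EuclideanSpace ℝ (Fin N), S.indicator (fun r => r ^ d) ‖x‖ with hI
  have hI0 : 0 ≤ I := integral_nonneg fun x => by
    simp only [Set.indicator]
    split_ifs <;> positivity
  refine ⟨C1 * I ^ (2 - 2 * t), by positivity, fun u hu hc R hR => ?_⟩
  have mu := hu.continuous.measurable
  refine (young_bilin (fun x => ENNReal.ofReal (‖x‖ ^ (-τ) * ‖u x‖ ^ p)) (truncKernel α R S)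
    (by fun_prop) (truncKernel_measurable α R S hS) t ht ht1).trans ?_
  have hk : ∫⁻ x : EuclideanSpace ℝ (Fin N), truncKernel α R S x ^ (1 / (2 - 2 * t)) =
      ENNReal.ofReal (R ^ (N + d) * I) := by
    rw [hI, ← kernel_scale S d hint R hR]
    refine lintegral_congr fun x => ?_
    unfold truncKernel
    simp only [Set.indicator]
    split_ifs
    · rw [ENNReal.ofReal_rpow_of_nonneg (by positivity) (by positivity), ← Real.rpow_mul (by positivity)]
      congr 2
      rw [hd]; ring
    · rw [ENNReal.ofReal_zero, ENNReal.zero_rpow_of_pos (by positivity)]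
  rw [hk]
  refine (mul_le_mul' (H1 u hu hc) le_rfl).trans (le_of_eq ?_)
  rw [ENNReal.ofReal_rpow_of_nonneg (by positivity) hd0.le, ← ENNReal.ofReal_mul' (by positivity)]
  congr 1
  rw [Real.mul_rpow (by positivity) hI0, ← Real.rpow_mul hR.le]
  have e : (N + d) * (2 - 2 * t) = N + α - 2 * N * t := by
    rw [hd, add_mul, div_mul_cancel₀ _ hd0.ne']; ring
  rw [e]; ring

lemma choose_R (M K A B e β γ : ℝ) (hM : 0 < M) (hK : 0 < K)
    (h1 : e / 2 + γ = A / 2) (h2 : β - e / 2 = B / 2) :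
    ((M / K) ^ ((1:ℝ) / 2)) ^ e * K ^ β * M ^ γ = M ^ (A / 2) * K ^ (B / 2) := by
  rw [← Real.rpow_mul (by positivity), Real.div_rpow hM.le hK.le, div_eq_mul_inv,
    ← Real.rpow_neg hK.le, ← h1, ← h2, Real.rpow_add hM, sub_eq_add_neg, Real.rpow_add hK]
  rw [show (1:ℝ) / 2 * e = e / 2 by ring]
  ring

lemma hartree_le {N : ℕ} (α τ p R : ℝ) (hR : 0 < R) (hα : 0 < α) (hαN : α < N)
    (u : EuclideanSpace ℝ (Fin N) → ℂ) (hu : Continuous u) :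
    ENNReal.ofReal (hartreeP α τ p u) ≤ ENNReal.ofReal (rieszConst N α) *
      ((∫⁻ x, ∫⁻ y, ENNReal.ofReal (‖x‖ ^ (-τ) * ‖u x‖ ^ p) * truncKernel α R (Set.Iio 1) (x - y) *
      ENNReal.ofReal (‖y‖ ^ (-τ) * ‖u y‖ ^ p)) +
      ∫⁻ x, ∫⁻ y, ENNReal.ofReal (‖x‖ ^ (-τ) * ‖u x‖ ^ p) * truncKernel α R (Set.Ici 1) (x - y) *
      ENNReal.ofReal (‖y‖ ^ (-τ) * ‖u y‖ ^ p)) := by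
  have mu := hu.measurable
  have mk1 := truncKernel_measurable (N := N) α R (Set.Iio 1) measurableSet_Iio
  have mk2 := truncKernel_measurable (N := N) α R (Set.Ici 1) measurableSet_Ici
  have hc0 : 0 ≤ rieszConst N α := by
    unfold rieszConst
    have h1 := Real.Gamma_pos_of_pos (show 0 < ((N:ℝ) - α) / 2 by linarith)
    have h2 := Real.Gamma_pos_of_pos (show 0 < α / 2 by linarith)
    positivity
  set f : EuclideanSpace ℝ (Fin N) → ℝ≥0∞ := fun x => ENNReal.ofReal (‖x‖ ^ (-τ) * ‖u x‖ ^ p) with hf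
  have mf : Measurable f := by fun_prop
  have hker : ∀ z : EuclideanSpace ℝ (Fin N), ENNReal.ofReal (‖z‖ ^ (α - (N:ℝ))) =
      truncKernel α R (Set.Iio 1) z + truncKernel α R (Set.Ici 1) z := by
    intro z
    have : R * (R⁻¹ * ‖z‖) = ‖z‖ := by field_simp
    unfold truncKernel
    rcases lt_or_ge (R⁻¹ * ‖z‖) 1 with h | h
    · rw [Set.indicator_of_mem (by exact h), Set.indicator_of_notMem (by simpa using h), this]
      simp
    · rw [Set.indicator_of_mem (s := Set.Ici 1) (by exact h), Set.indicator_of_notMem (by simpa using h), this]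
      simp
  have h1 : ENNReal.ofReal (hartreeP α τ p u) ≤ ‖hartreeP α τ p u‖ₑ := by
    rw [← ofReal_norm]
    exact ENNReal.ofReal_le_ofReal (le_abs_self _)
  refine h1.trans ((enorm_integral_le_lintegral_enorm _).trans ?_)
  have h2 : ∀ x, ‖‖x‖ ^ (-τ) * rieszConvR α (fun y => ‖y‖ ^ (-τ) * ‖u y‖ ^ p) x * ‖u x‖ ^ p‖ₑ ≤
      ENNReal.ofReal (rieszConst N α) * ((∫⁻ y, f x * truncKernel α R (Set.Iio 1) (x - y) * f y) +
        ∫⁻ y, f x * truncKernel α R (Set.Ici 1) (x - y) * f y) := by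
    intro x
    have e1 : ‖‖x‖ ^ (-τ) * rieszConvR α (fun y => ‖y‖ ^ (-τ) * ‖u y‖ ^ p) x * ‖u x‖ ^ p‖ₑ =
        f x * ‖rieszConvR α (fun y => ‖y‖ ^ (-τ) * ‖u y‖ ^ p) x‖ₑ := by
      rw [show ‖x‖ ^ (-τ) * rieszConvR α (fun y => ‖y‖ ^ (-τ) * ‖u y‖ ^ p) x * ‖u x‖ ^ p =
        (‖x‖ ^ (-τ) * ‖u x‖ ^ p) * rieszConvR α (fun y => ‖y‖ ^ (-τ) * ‖u y‖ ^ p) x by ring,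
        enorm_mul, Real.enorm_of_nonneg (r := ‖x‖ ^ (-τ) * ‖u x‖ ^ p) (by positivity)]
    rw [e1]
    refine (mul_le_mul' le_rfl (enorm_integral_le_lintegral_enorm _)).trans (le_of_eq ?_)
    rw [← lintegral_const_mul' _ _ ENNReal.ofReal_ne_top, ← lintegral_add_left (by fun_prop),
      ← lintegral_const_mul' _ _ ENNReal.ofReal_ne_top]
    refine lintegral_congr fun y => ?_
    have e2 : ‖rieszConst N α * ‖x - y‖ ^ (α - (N:ℝ)) * (‖y‖ ^ (-τ) * ‖u y‖ ^ p)‖ₑ =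
        ENNReal.ofReal (rieszConst N α) * (truncKernel α R (Set.Iio 1) (x - y) +
          truncKernel α R (Set.Ici 1) (x - y)) * f y := by
      rw [Real.enorm_of_nonneg (by positivity), ENNReal.ofReal_mul (by positivity),
        ENNReal.ofReal_mul hc0, hker]
    refine (congrArg (f x * ·) e2).trans ?_
    ring
  refine (lintegral_mono h2).trans (le_of_eq ?_)
  rw [lintegral_const_mul' _ _ ENNReal.ofReal_ne_top, lintegral_add_left]
  refine Measurable.lintegral_prod_right' (f := fun z : EuclideanSpace ℝ (Fin N) × EuclideanSpace ℝ (Fin N) =>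
    f z.1 * truncKernel α R (Set.Iio 1) (z.1 - z.2) * f z.2) ?_
  fun_prop

set_option maxHeartbeats 1000000 in
/-- **Gagliardo–Nirenberg inequality for the inhomogeneous Hartree nonlinearity,
inverse-square potential case.** -/
theorem gn_hartree_inverse_square (N : ℕ) (hN : 3 ≤ N) (α τ lam p B A : ℝ)
    (hα : 0 < α) (hαN : α < N) (hlam : -(((N : ℝ) - 2) ^ 2 / 4) < lam)
    (hτ : 0 < τ) (hτN : τ < N) (hcnd : 0 < 2 - 2 * τ + α)
    (hp1 : 1 + α / N < p) (hp2 : p < 1 + (2 - 2 * τ + α) / ((N : ℝ) - 2))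
    (hB : B = N * p - N - α + 2 * τ) (hA : A = 2 * p - B) :
    ∃ C > 0, ∀ u : EuclideanSpace ℝ (Fin N) → ℂ,
      ContDiff ℝ (⊤ : ℕ∞) u → HasCompactSupport u →
      hartreeP α τ p u ≤ C * l2norm u ^ A * kineticK lam u ^ (B / 2) := by
  have hN' : (3:ℝ) ≤ N := by exact_mod_cast hN
  have hN2 : (0:ℝ) < N - 2 := by linarith
  have hN0 : (0:ℝ) < N := by linarith
  have hαN0 : 0 < α / N := by positivity
  have hp : 0 < p := by linarith
  set t0 : ℝ := (N + α) / (2 * N) with ht0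
  set L : ℝ := τ / N + p * (N - 2) / (2 * N) with hL
  have hp2' : (p - 1) * (N - 2) < 2 - 2 * τ + α := by
    rw [← lt_div_iff₀ hN2]; linarith
  have hp1' : N + α < p * N := by
    have : α / N < p - 1 := by linarith
    rw [div_lt_iff₀ hN0] at this; linarith
  have hLt : L < t0 := by
    have : t0 - L = (2 - 2 * τ + α - (p - 1) * (N - 2)) / (2 * N) := by
      rw [ht0, hL]; field_simp; ring
    have h : 0 < t0 - L := by
      rw [this]; exact div_pos (by linarith) (by positivity)
    linarith
  have hht : 1 / 2 < t0 := by rw [ht0, lt_div_iff₀ (by positivity)]; linarith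
  have ht01 : t0 < 1 := by rw [ht0, div_lt_iff₀ (by positivity)]; linarith
  have ht0p : t0 < p / 2 := by rw [ht0, div_lt_iff₀ (by positivity)]; linarith
  have hNt0 : 2 * N * t0 = N + α := by rw [ht0]; field_simp
  obtain ⟨t1, ht1, ht1'⟩ := exists_between (max_lt hLt hht)
  obtain ⟨t2, ht2, ht2'⟩ := exists_between (lt_min ht01 ht0p)
  rw [max_lt_iff] at ht1
  rw [lt_min_iff] at ht2'
  obtain ⟨C1, hC1, H1⟩ := term_bound N hN lam τ p t1 α hlam hτ hp ht1.2 (by linarith) (by linarith)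
    ht1.1 (Set.Iio 1) measurableSet_Iio (kernel_near (by omega) _ (by
      rw [lt_div_iff₀ (by linarith)]; nlinarith))
  obtain ⟨C2, hC2, H2⟩ := term_bound N hN lam τ p t2 α hlam hτ hp (by linarith) ht2'.1 (by linarith)
    (by linarith) (Set.Ici 1) measurableSet_Ici (kernel_far (by omega) _ (by
      rw [div_lt_iff₀ (by linarith)]; nlinarith))
  obtain ⟨c1, hc1, HK⟩ := kinetic_bound N hN lam hlam
  have hβ : ∀ t, t < p / 2 → 0 < τ + N * p / 2 - N * t := by
    intro t ht
    nlinarith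
  have hγ : ∀ t, L < t → 0 < p - (τ + N * p / 2 - N * t) := by
    intro t ht
    have : p - (τ + N * p / 2 - N * t) = N * (t - L) := by
      rw [hL]; field_simp; ring
    rw [this]
    exact mul_pos hN0 (by linarith)
  have hc0 : 0 ≤ rieszConst N α := by
    unfold rieszConst
    have h1 := Real.Gamma_pos_of_pos (show 0 < ((N:ℝ) - α) / 2 by linarith)
    have h2 := Real.Gamma_pos_of_pos (show 0 < α / 2 by linarith)
    positivity
  refine ⟨rieszConst N α * (C1 + C2) + 1, by positivity, fun u hu hc => ?_⟩
  have hu1 : ContDiff ℝ 1 u := hu.of_le (by exact_mod_cast le_top)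
  have hK : 0 ≤ kineticK lam u := by
    have h1 := HK u hu1 hc
    have h2 : 0 ≤ ∫ x, gradNormSq u x := integral_nonneg (gradNormSq_nonneg u)
    by_contra hneg
    push Not at hneg
    nlinarith [mul_neg_of_pos_of_neg hc1 hneg]
  have hM : 0 ≤ ∫ x, ‖u x‖ ^ 2 := integral_nonneg fun x => by positivity
  have hl2 : l2norm u ^ A = (∫ x, ‖u x‖ ^ 2) ^ (A / 2) := by
    unfold l2norm
    rw [← Real.rpow_mul hM]; congr 1; ring
  rw [hl2]
  set M := ∫ x, ‖u x‖ ^ 2 with hMdef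
  set K := kineticK lam u with hKdef
  have main : ∀ R : ℝ, 0 < R → ∀ Y : ℝ, 0 ≤ Y →
      R ^ (N + α - 2 * N * t1) * K ^ (τ + N * p / 2 - N * t1) * M ^ (p - (τ + N * p / 2 - N * t1)) = Y →
      R ^ (N + α - 2 * N * t2) * K ^ (τ + N * p / 2 - N * t2) * M ^ (p - (τ + N * p / 2 - N * t2)) = Y →
      hartreeP α τ p u ≤ rieszConst N α * (C1 + C2) * Y := by
    intro R hR Y hY h1 h2
    have a0 := hartree_le α τ p R hR hα hαN u hu1.continuous
    have a1 := H1 u hu1 hc R hR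
    have a2 := H2 u hu1 hc R hR
    rw [← hMdef, ← hKdef, h1] at a1
    rw [← hMdef, ← hKdef, h2] at a2
    have a3 := a0.trans (mul_le_mul' le_rfl (add_le_add a1 a2))
    rw [← ENNReal.ofReal_add (by positivity) (by positivity), ← ENNReal.ofReal_mul hc0,
      ENNReal.ofReal_le_ofReal_iff (by positivity)] at a3
    refine a3.trans (le_of_eq ?_)
    ring
  have hY0 : 0 ≤ M ^ (A / 2) * K ^ (B / 2) := by positivity
  have hfin : rieszConst N α * (C1 + C2) * (M ^ (A / 2) * K ^ (B / 2)) ≤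
      (rieszConst N α * (C1 + C2) + 1) * M ^ (A / 2) * K ^ (B / 2) := by
    nlinarith
  refine le_trans ?_ hfin
  by_cases h0 : M = 0 ∨ K = 0
  · have hz : ∀ t, t < p / 2 → L < t →
        (1:ℝ) ^ (N + α - 2 * N * t) * K ^ (τ + N * p / 2 - N * t) * M ^ (p - (τ + N * p / 2 - N * t)) = 0 := by
      intro t ha hb
      rcases h0 with h | h
      · rw [h, Real.zero_rpow (hγ t hb).ne', mul_zero]
      · rw [h, Real.zero_rpow (hβ t ha).ne', mul_zero, zero_mul]
    have := main 1 one_pos 0 le_rfl (hz t1 (by linarith) ht1.1) (hz t2 ht2'.2 (by linarith))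
    refine this.trans ?_
    rw [mul_zero]; positivity
  · push Not at h0
    have hM' : 0 < M := lt_of_le_of_ne hM (Ne.symm h0.1)
    have hK' : 0 < K := lt_of_le_of_ne hK (Ne.symm h0.2)
    refine main ((M / K) ^ ((1:ℝ) / 2)) 
      (Real.rpow_pos_of_pos (div_pos hM' hK') _) _ hY0 ?_ ?_
    · exact choose_R M K A B _ _ _ hM' hK' (by rw [hA, hB]; ring) (by rw [hB]; ring)
    · exact choose_R M K A B _ _ _ hM' hK' (by rw [hA, hB]; ring) (by rw [hB]; ring)
end

section
/- (Gagliardo–Nirenberg inequality for the inhomogeneous local nonlinearity, bi-harmonic case.) Let N ≥ 5, 0 < τ < 2, and 1 < q < 1 + (4 − 2τ)/(N−4). Set B' := (Nq − N + 2τ)/2 and A' := 2q − B'. Then there exists a constant C > 0 such that for every smooth compactly supported v : ℝ^N → ℂ, Q[v] ≤ C ‖v‖^{A'} ‖Δv‖^{B'}, where Δv is the Laplacian of v. -/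
open MeasureTheory

/-- The Laplacian of a function on `ℝ^N`. -/
noncomputable def lap {N : ℕ} {E : Type*} [NormedAddCommGroup E] [NormedSpace ℝ E]
    (u : EuclideanSpace ℝ (Fin N) → E) (x : EuclideanSpace ℝ (Fin N)) : E :=
  ∑ i, fderiv ℝ (fun y => fderiv ℝ u y (EuclideanSpace.single i 1)) x
    (EuclideanSpace.single i 1)

/-- The weighted potential energy `Q[v] = ∫ |x|^{-2τ} |v(x)|^{2q} dx`. -/
noncomputable def potQ {N : ℕ} (τ q : ℝ) (v : EuclideanSpace ℝ (Fin N) → ℂ) : ℝ :=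
  ∫ x, ‖x‖ ^ (-(2 * τ)) * ‖v x‖ ^ (2 * q)

/-- Partial derivative in the `i`-th coordinate direction. -/
noncomputable def pdv {N : ℕ} {F : Type*} [NormedAddCommGroup F] [NormedSpace ℝ F] (i : Fin N)
    (u : EuclideanSpace ℝ (Fin N) → F) (x : EuclideanSpace ℝ (Fin N)) : F :=
  fderiv ℝ u x (EuclideanSpace.single i 1)

lemma pdv_smooth {N : ℕ} {F : Type*} [NormedAddCommGroup F] [NormedSpace ℝ F] (i : Fin N)
    {u : EuclideanSpace ℝ (Fin N) → F} (hu : ContDiff ℝ (⊤ : ℕ∞) u) :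
    ContDiff ℝ (⊤ : ℕ∞) (pdv i u) := by
  have h : ContDiff ℝ (⊤ : ℕ∞) (fderiv ℝ u) := hu.fderiv_right (by simp)
  exact h.clm_apply contDiff_const

lemma pdv_supp {N : ℕ} {F : Type*} [NormedAddCommGroup F] [NormedSpace ℝ F] (i : Fin N)
    {u : EuclideanSpace ℝ (Fin N) → F} (hu : HasCompactSupport u) :
    HasCompactSupport (pdv i u) :=
  hu.fderiv_apply (𝕜 := ℝ) _

lemma pdv_comm {N : ℕ} (i j : Fin N)
    {u : EuclideanSpace ℝ (Fin N) → ℂ} (hu : ContDiff ℝ (⊤ : ℕ∞) u) :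
    pdv i (pdv j u) = pdv j (pdv i u) := by
  have h : ContDiff ℝ (⊤ : ℕ∞) (fderiv ℝ u) := hu.fderiv_right (by simp)
  have key : ∀ (i j : Fin N) x, pdv i (pdv j u) x =
      fderiv ℝ (fderiv ℝ u) x (EuclideanSpace.single i 1) (EuclideanSpace.single j 1) := by
    intro i j x
    have hd : DifferentiableAt ℝ (fderiv ℝ u) x := (h.differentiable (by simp)) x
    unfold pdv
    rw [fderiv_clm_apply hd (differentiableAt_const _)]
    simp
  funext x
  rw [key, key]
  have hs : IsSymmSndFDerivAt ℝ u x := hu.contDiffAt.isSymmSndFDerivAt (by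
    simp only [minSmoothness_of_isRCLikeNormedField]; exact WithTop.coe_le_coe.2 (le_top : (2 : ℕ∞) ≤ ⊤))
  exact hs _ _

lemma ibp {N : ℕ} (i : Fin N) {f g : EuclideanSpace ℝ (Fin N) → ℂ}
    (hf : ContDiff ℝ (⊤ : ℕ∞) f) (hg : ContDiff ℝ (⊤ : ℕ∞) g) (hfs : HasCompactSupport f)
    (hgs : HasCompactSupport g) :
    ∫ x, inner ℝ (f x) (pdv i g x) = - ∫ x, inner ℝ (pdv i f x) (g x) := by
  have h := integral_bilinear_fderiv_right_eq_neg_left_of_integrable (μ := volume)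
    (f := f) (g := g) (v := EuclideanSpace.single i 1) (B := innerSL ℝ (E := ℂ)) ?_ ?_ ?_ ?_ ?_
  · exact h
  · apply Continuous.integrable_of_hasCompactSupport
    · exact ((innerSL ℝ (E := ℂ)).continuous.comp (pdv_smooth i hf).continuous).clm_apply hg.continuous
    · apply hgs.mono'
      refine Function.support_subset_iff'.2 fun x hx => ?_
      simp [image_eq_zero_of_notMem_tsupport hx]
  · apply Continuous.integrable_of_hasCompactSupport
    · exact ((innerSL ℝ (E := ℂ)).continuous.comp hf.continuous).clm_apply (pdv_smooth i hg).continuous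
    · apply hfs.mono'
      refine Function.support_subset_iff'.2 fun x hx => ?_
      simp [image_eq_zero_of_notMem_tsupport hx]
  · apply Continuous.integrable_of_hasCompactSupport
    · exact ((innerSL ℝ (E := ℂ)).continuous.comp hf.continuous).clm_apply hg.continuous
    · apply hfs.mono'
      refine Function.support_subset_iff'.2 fun x hx => ?_
      simp [image_eq_zero_of_notMem_tsupport hx]
  · intro x _; exact hf.differentiable (by simp) x
  · intro x _; exact hg.differentiable (by simp) x

lemma int_mul_sq {N : ℕ} {F : Type*} [NormedAddCommGroup F] [NormedSpace ℝ F]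
    {u : EuclideanSpace ℝ (Fin N) → F} (hu : Continuous u)
    (hs : HasCompactSupport u) {w : EuclideanSpace ℝ (Fin N) → ℝ} (hw : Continuous w) :
    Integrable (fun x => w x * ‖u x‖ ^ 2) := by
  apply Continuous.integrable_of_hasCompactSupport
  · fun_prop
  · apply hs.mono'
    refine Function.support_subset_iff'.2 fun x hx => ?_
    simp [image_eq_zero_of_notMem_tsupport hx]

lemma int_sq {N : ℕ} {F : Type*} [NormedAddCommGroup F] [NormedSpace ℝ F]
    {u : EuclideanSpace ℝ (Fin N) → F} (hu : Continuous u)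
    (hs : HasCompactSupport u) : Integrable (fun x => ‖u x‖ ^ 2) := by
  simpa using int_mul_sq hu hs (w := fun _ => 1) continuous_const

lemma hess_eq {N : ℕ} {v : EuclideanSpace ℝ (Fin N) → ℂ}
    (hv : ContDiff ℝ (⊤ : ℕ∞) v) (hs : HasCompactSupport v) :
    ∑ i, ∑ j, ∫ x, ‖pdv j (pdv i v) x‖ ^ 2 = ∫ x, ‖lap v x‖ ^ 2 := by
  have h1 : ∀ i j, ∫ x, ‖pdv j (pdv i v) x‖ ^ 2
      = ∫ x, inner ℝ (pdv i (pdv i v) x) (pdv j (pdv j v) x) := by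
    intro i j
    simp_rw [← real_inner_self_eq_norm_sq]
    have a := ibp j (f := pdv j (pdv i v)) (g := pdv i v) (pdv_smooth _ (pdv_smooth _ hv))
      (pdv_smooth _ hv) (pdv_supp _ (pdv_supp _ hs)) (pdv_supp _ hs)
    have b := ibp i (f := pdv j (pdv j v)) (g := pdv i v) (pdv_smooth _ (pdv_smooth _ hv))
      (pdv_smooth _ hv) (pdv_supp _ (pdv_supp _ hs)) (pdv_supp _ hs)
    rw [a]
    rw [pdv_comm j i hv, pdv_comm j i (pdv_smooth _ hv), ← b]
    simp_rw [real_inner_comm]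
  have hint : ∀ i j, Integrable (fun x => inner ℝ (pdv i (pdv i v) x) (pdv j (pdv j v) x)) := by
    intro i j
    apply Continuous.integrable_of_hasCompactSupport
    · exact (pdv_smooth _ (pdv_smooth _ hv)).continuous.inner
        (pdv_smooth _ (pdv_smooth _ hv)).continuous
    · apply (pdv_supp i (pdv_supp i hs)).mono'
      refine Function.support_subset_iff'.2 fun x hx => ?_
      simp [image_eq_zero_of_notMem_tsupport hx]
  simp_rw [h1]
  have h2 : ∀ x, ‖lap v x‖ ^ 2 = ∑ i, ∑ j, inner ℝ (pdv i (pdv i v) x) (pdv j (pdv j v) x) := by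
    intro x
    rw [← real_inner_self_eq_norm_sq]
    have : lap v x = ∑ i, pdv i (pdv i v) x := rfl
    rw [this, sum_inner]
    simp_rw [inner_sum]
  simp_rw [h2]
  rw [integral_finsetSum]
  · refine Finset.sum_congr rfl fun i _ => ?_
    rw [integral_finsetSum]
    intro j _; exact hint i j
  · intro i _
    exact integrable_finsetSum _ fun j _ => hint i j

/-- Regularised weight. -/
noncomputable def wt {N : ℕ} (ε : ℝ) (k : ℕ) (x : EuclideanSpace ℝ (Fin N)) : ℝ :=
  ((‖x‖ ^ 2 + ε) ^ k)⁻¹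

lemma wt_cont {N : ℕ} {ε : ℝ} (hε : 0 < ε) (k : ℕ) : Continuous (wt (N := N) ε k) := by
  unfold wt
  refine Continuous.inv₀ (by fun_prop) fun x => by positivity

lemma wt_deriv {N : ℕ} {ε : ℝ} (hε : 0 < ε) (k : ℕ) (i : Fin N) (x : EuclideanSpace ℝ (Fin N)) :
    DifferentiableAt ℝ (fun x : EuclideanSpace ℝ (Fin N) => x i * wt ε (k+1) x) x ∧
    pdv i (fun x : EuclideanSpace ℝ (Fin N) => x i * wt ε (k+1) x) x
      = wt ε (k+1) x - 2 * (k+1) * x i ^ 2 * wt ε (k+2) x := by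
  have h1 : HasFDerivAt (fun x : EuclideanSpace ℝ (Fin N) => ‖x‖ ^ 2) _ x :=
    (hasStrictFDerivAt_norm_sq x).hasFDerivAt
  have hne : (‖x‖ ^ 2 + ε) ≠ 0 := by positivity
  have h2 := (((hasDerivAt_id (‖x‖ ^ 2)).add_const ε).pow (k+1)).inv (by simpa using hne)
  have h3 := h2.comp_hasFDerivAt x h1
  have h4 := ((EuclideanSpace.proj i : EuclideanSpace ℝ (Fin N) →L[ℝ] ℝ).hasFDerivAt (x := x)).mul h3
  have h5 : HasFDerivAt (fun x : EuclideanSpace ℝ (Fin N) => x i * wt ε (k+1) x) _ x := h4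
  refine ⟨h5.differentiableAt, ?_⟩
  unfold pdv
  rw [h5.fderiv]
  simp [wt, EuclideanSpace.inner_single_right]
  field_simp
  ring

lemma hardy_s7 {N : ℕ} {ε : ℝ} (hε : 0 < ε) (k : ℕ) (hk : 2 * (k + 1) < N)
    {u : EuclideanSpace ℝ (Fin N) → ℂ}
    (hu : ContDiff ℝ (⊤ : ℕ∞) u) (hs : HasCompactSupport u) :
    ∫ x, wt ε (k+1) x * ‖u x‖ ^ 2 ≤
      (2 / ((N : ℝ) - 2 * (k+1))) ^ 2 * ∑ i, ∫ x, wt ε k x * ‖pdv i u x‖ ^ 2 := by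
  set c : ℝ := (N : ℝ) - 2 * (k+1) with hc
  have hcpos : 0 < c := by
    have : ((2 * (k + 1) : ℕ) : ℝ) < N := by exact_mod_cast hk
    push_cast at this; linarith
  have hf : ContDiff ℝ (⊤ : ℕ∞) (fun x => ‖u x‖ ^ 2) := hu.norm_sq ℝ
  have hpf : ∀ i x, pdv i (fun x => ‖u x‖ ^ 2) x = 2 * inner ℝ (u x) (pdv i u x) := by
    intro i x
    have := ((hu.differentiable (by simp)) x).hasFDerivAt.norm_sq
    unfold pdv
    rw [this.fderiv]; simp; ring
  have hI1 : ∀ i, Integrable (fun x : EuclideanSpace ℝ (Fin N) =>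
      (wt ε (k+1) x - 2 * (k+1) * x i ^ 2 * wt ε (k+2) x) * ‖u x‖ ^ 2) := by
    intro i
    have := wt_cont (N := N) hε (k+1)
    have := wt_cont (N := N) hε (k+2)
    exact int_mul_sq hu.continuous hs (by fun_prop)
  have hI2 : ∀ i, Integrable (fun x : EuclideanSpace ℝ (Fin N) =>
      (x i * wt ε (k+1) x) * (2 * inner ℝ (u x) (pdv i u x))) := by
    intro i
    have := wt_cont (N := N) hε (k+1)
    have := hu.continuous
    have := (pdv_smooth i hu).continuous
    apply Continuous.integrable_of_hasCompactSupport
    · fun_prop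
    · apply hs.mono'
      refine Function.support_subset_iff'.2 fun x hx => ?_
      simp [image_eq_zero_of_notMem_tsupport hx]
  have hibp : ∀ i, ∫ x : EuclideanSpace ℝ (Fin N), (x i * wt ε (k+1) x) * (2 * inner ℝ (u x) (pdv i u x))
      = - ∫ x : EuclideanSpace ℝ (Fin N),
        (wt ε (k+1) x - 2 * (k+1) * x i ^ 2 * wt ε (k+2) x) * ‖u x‖ ^ 2 := by
    intro i
    have h := integral_mul_fderiv_eq_neg_fderiv_mul_of_integrable (𝕜 := ℝ) (μ := volume)
      (f := fun x : EuclideanSpace ℝ (Fin N) => x i * wt ε (k+1) x)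
      (g := fun x => ‖u x‖ ^ 2) (v := EuclideanSpace.single i 1) ?_ ?_ ?_ ?_ ?_
    · have e1 : ∀ x, fderiv ℝ (fun x => ‖u x‖ ^ 2) x (EuclideanSpace.single i 1) =
        2 * inner ℝ (u x) (pdv i u x) := hpf i
      have e2 := fun x => (wt_deriv hε k i x).2
      unfold pdv at e2
      simp_rw [e1, e2] at h
      exact h
    · have e2 := fun x => (wt_deriv hε k i x).2
      unfold pdv at e2
      simp_rw [e2]
      exact hI1 i
    · have e1 : ∀ x, fderiv ℝ (fun x => ‖u x‖ ^ 2) x (EuclideanSpace.single i 1) =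
        2 * inner ℝ (u x) (pdv i u x) := hpf i
      simp_rw [e1]
      exact hI2 i
    · have := wt_cont (N := N) hε (k+1)
      exact int_mul_sq hu.continuous hs (by fun_prop)
    · intro x _; exact (wt_deriv hε k i x).1
    · intro x _; exact hf.differentiable (by simp) x
  have hIw : Integrable (fun x : EuclideanSpace ℝ (Fin N) => wt ε (k+1) x * ‖u x‖ ^ 2) :=
    int_mul_sq hu.continuous hs (wt_cont hε _)
  have hIg : ∀ i, Integrable (fun x : EuclideanSpace ℝ (Fin N) => wt ε k x * ‖pdv i u x‖ ^ 2) :=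
    fun i => int_mul_sq (pdv_smooth i hu).continuous (pdv_supp i hs) (wt_cont hε _)
  have hsum : ∫ x : EuclideanSpace ℝ (Fin N), ((∑ i, (wt ε (k+1) x - 2 * (k+1) * x i ^ 2 * wt ε (k+2) x) * ‖u x‖ ^ 2)
      + ∑ i, (x i * wt ε (k+1) x) * (2 * inner ℝ (u x) (pdv i u x))) = 0 := by
    rw [integral_add (integrable_finsetSum _ fun i _ => hI1 i)
      (integrable_finsetSum _ fun i _ => hI2 i), integral_finsetSum _ fun i _ => hI1 i,
      integral_finsetSum _ fun i _ => hI2 i, ← Finset.sum_add_distrib]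
    refine Finset.sum_eq_zero fun i _ => ?_
    rw [hibp i]; ring
  have hpt : ∀ x : EuclideanSpace ℝ (Fin N), c / 2 * (wt ε (k+1) x * ‖u x‖ ^ 2)
      - 2 / c * ∑ i, wt ε k x * ‖pdv i u x‖ ^ 2 ≤
      (∑ i, (wt ε (k+1) x - 2 * (k+1) * x i ^ 2 * wt ε (k+2) x) * ‖u x‖ ^ 2)
      + ∑ i, (x i * wt ε (k+1) x) * (2 * inner ℝ (u x) (pdv i u x)) := by
    intro x
    have hx2 : ∑ i, x i ^ 2 = ‖x‖ ^ 2 := (EuclideanSpace.real_norm_sq_eq x).symm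
    set y := ∑ i, x i • pdv i u x with hy
    have hy2 : ‖y‖ ^ 2 ≤ ‖x‖ ^ 2 * ∑ i, ‖pdv i u x‖ ^ 2 := by
      have a : ‖y‖ ≤ ∑ i, |x i| * ‖pdv i u x‖ := by
        refine (norm_sum_le _ _).trans (le_of_eq ?_)
        simp
      have b := Finset.sum_mul_sq_le_sq_mul_sq Finset.univ (fun i => |x i|) (fun i => ‖pdv i u x‖)
      simp only [sq_abs, hx2] at b
      exact (pow_le_pow_left₀ (norm_nonneg _) a 2).trans b
    have hw1 : 0 < wt ε (k+1) x := by unfold wt; positivity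
    have hwa : ‖x‖ ^ 2 * wt ε (k+2) x ≤ wt ε (k+1) x := by
      unfold wt
      rw [pow_succ _ (k+1), mul_inv, mul_left_comm]
      refine mul_le_of_le_one_right (by positivity) ?_
      rw [mul_inv_le_iff₀ (by positivity)]; linarith
    have hwb : ‖x‖ ^ 2 * wt ε (k+1) x ≤ wt ε k x := by
      unfold wt
      rw [pow_succ _ k, mul_inv, mul_left_comm]
      refine mul_le_of_le_one_right (by positivity) ?_
      rw [mul_inv_le_iff₀ (by positivity)]; linarith
    have s1 : ∑ i, (wt ε (k+1) x - 2 * (k+1) * x i ^ 2 * wt ε (k+2) x) * ‖u x‖ ^ 2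
        = (N * wt ε (k+1) x - 2 * (k+1) * (‖x‖ ^ 2 * wt ε (k+2) x)) * ‖u x‖ ^ 2 := by
      rw [← Finset.sum_mul, Finset.sum_sub_distrib, ← Finset.sum_mul, ← Finset.mul_sum, hx2]
      simp; left; ring
    have s2 : ∑ i, (x i * wt ε (k+1) x) * (2 * inner ℝ (u x) (pdv i u x))
        = 2 * wt ε (k+1) x * inner ℝ (u x) y := by
      rw [hy, inner_sum, Finset.mul_sum]
      refine Finset.sum_congr rfl fun i _ => ?_
      rw [real_inner_smul_right]; ring
    rw [s1, s2, ← Finset.mul_sum]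
    set S := ∑ i, ‖pdv i u x‖ ^ 2
    have hS : 0 ≤ S := Finset.sum_nonneg fun i _ => by positivity
    have t1 : c * (wt ε (k+1) x * ‖u x‖ ^ 2) ≤
        (N * wt ε (k+1) x - 2 * (k+1) * (‖x‖ ^ 2 * wt ε (k+2) x)) * ‖u x‖ ^ 2 := by
      rw [← mul_assoc]
      refine mul_le_mul_of_nonneg_right ?_ (by positivity)
      have : (2 * ((k:ℝ)+1)) * (‖x‖ ^ 2 * wt ε (k+2) x) ≤ (2 * ((k:ℝ)+1)) * wt ε (k+1) x :=
        mul_le_mul_of_nonneg_left hwa (by positivity)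
      rw [hc]; linarith
    have t2 : -(c / 2 * ‖u x‖ ^ 2 + 2 / c * ‖y‖ ^ 2) ≤ 2 * inner ℝ (u x) y := by
      have a := neg_le_of_abs_le (abs_real_inner_le_norm (u x) y)
      have b : 2 * (‖u x‖ * ‖y‖) ≤ c / 2 * ‖u x‖ ^ 2 + 2 / c * ‖y‖ ^ 2 := by
        have : c / 2 * ‖u x‖ ^ 2 + 2 / c * ‖y‖ ^ 2 - 2 * (‖u x‖ * ‖y‖)
          = (c * ‖u x‖ - 2 * ‖y‖) ^ 2 / (2 * c) := by field_simp; ring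
        have h0 : 0 ≤ (c * ‖u x‖ - 2 * ‖y‖) ^ 2 / (2 * c) := by positivity
        linarith
      linarith
    have t3 : wt ε (k+1) x * ‖y‖ ^ 2 ≤ wt ε k x * S := by
      calc _ ≤ wt ε (k+1) x * (‖x‖ ^ 2 * S) := mul_le_mul_of_nonneg_left hy2 hw1.le
        _ = (‖x‖ ^ 2 * wt ε (k+1) x) * S := by ring
        _ ≤ _ := mul_le_mul_of_nonneg_right hwb hS
    have t4 := mul_le_mul_of_nonneg_left t2 hw1.le
    have t5 := mul_le_mul_of_nonneg_left t3 (by positivity : 0 ≤ 2 / c)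
    nlinarith [t1, t4, t5]
  have hfin := integral_mono ((hIw.const_mul (c/2)).sub
    ((integrable_finsetSum _ fun i _ => hIg i).const_mul (2/c)))
    ((integrable_finsetSum _ fun i _ => hI1 i).add
      (integrable_finsetSum _ fun i _ => hI2 i)) hpt
  have hfin2 := hfin.trans_eq hsum
  have e : ∫ x : EuclideanSpace ℝ (Fin N), (c / 2 * (wt ε (k+1) x * ‖u x‖ ^ 2)
      - 2 / c * ∑ i, wt ε k x * ‖pdv i u x‖ ^ 2) = c / 2 * (∫ x, wt ε (k+1) x * ‖u x‖ ^ 2)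
      - 2 / c * ∑ i, ∫ x, wt ε k x * ‖pdv i u x‖ ^ 2 := by
    rw [integral_sub (hIw.const_mul (c/2))
      ((integrable_finsetSum _ fun i _ => hIg i).const_mul (2/c)), integral_const_mul,
      integral_const_mul, integral_finsetSum _ fun i _ => hIg i]
  have hfin3 : c / 2 * (∫ x, wt ε (k+1) x * ‖u x‖ ^ 2)
      - 2 / c * ∑ i, ∫ x, wt ε k x * ‖pdv i u x‖ ^ 2 ≤ 0 := e ▸ hfin2
  have := mul_le_mul_of_nonneg_left hfin3 (by positivity : 0 ≤ 2 / c)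
  have e2 : 2 / c * (c / 2 * (∫ x, wt ε (k+1) x * ‖u x‖ ^ 2)
      - 2 / c * ∑ i, ∫ x, wt ε k x * ‖pdv i u x‖ ^ 2) = (∫ x, wt ε (k+1) x * ‖u x‖ ^ 2)
      - (2 / c) ^ 2 * ∑ i, ∫ x, wt ε k x * ‖pdv i u x‖ ^ 2 := by field_simp
  linarith

lemma rellich_eps {N : ℕ} (hN : 5 ≤ N) {ε : ℝ} (hε : 0 < ε)
    {v : EuclideanSpace ℝ (Fin N) → ℂ}
    (hv : ContDiff ℝ (⊤ : ℕ∞) v) (hs : HasCompactSupport v) :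
    ∫ x, wt ε 2 x * ‖v x‖ ^ 2 ≤
      (2 / ((N : ℝ) - 4)) ^ 2 * (2 / ((N : ℝ) - 2)) ^ 2 * ∫ x, ‖lap v x‖ ^ 2 := by
  have h1 := hardy_s7 hε 1 (by omega) hv hs
  have h2 := fun i => hardy_s7 hε 0 (by omega) (pdv_smooth i hv) (pdv_supp i hs)
  have hw : ∀ x : EuclideanSpace ℝ (Fin N), wt ε 0 x = 1 := fun x => by simp [wt]
  simp only [hw, one_mul] at h2
  rw [← hess_eq hv hs, mul_assoc, Finset.mul_sum]
  have h3 := Finset.sum_le_sum fun i (_ : i ∈ Finset.univ) => h2 i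
  have e1 : (N : ℝ) - 2 * ((1 : ℕ) + 1) = N - 4 := by push_cast; ring
  have e2 : (N : ℝ) - 2 * ((0 : ℕ) + 1) = N - 2 := by push_cast; ring
  rw [e1] at h1
  rw [e2] at h3
  exact h1.trans (mul_le_mul_of_nonneg_left h3 (by positivity))

lemma clm_norm_sq_le {N : ℕ} {F : Type*} [NormedAddCommGroup F] [NormedSpace ℝ F]
    (L : EuclideanSpace ℝ (Fin N) →L[ℝ] F) :
    ‖L‖ ^ 2 ≤ ∑ i, ‖L (EuclideanSpace.single i 1)‖ ^ 2 := by
  set S := ∑ i, ‖L (EuclideanSpace.single i 1)‖ ^ 2 with hS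
  have hS0 : 0 ≤ S := Finset.sum_nonneg fun i _ => by positivity
  have h : ‖L‖ ≤ √S := by
    refine L.opNorm_le_bound (Real.sqrt_nonneg _) fun x => ?_
    have hx : x = ∑ i, x i • (EuclideanSpace.single i 1 : EuclideanSpace ℝ (Fin N)) := by
      ext j; simp [Finset.sum_apply, Pi.single_apply]
    have hx2 : ∑ i, x i ^ 2 = ‖x‖ ^ 2 := (EuclideanSpace.real_norm_sq_eq x).symm
    have a : ‖L x‖ ≤ ∑ i, |x i| * ‖L (EuclideanSpace.single i 1)‖ := by
      conv_lhs => rw [hx]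
      rw [map_sum]
      refine (norm_sum_le _ _).trans (le_of_eq ?_)
      simp [norm_smul]
    have b := Finset.sum_mul_sq_le_sq_mul_sq Finset.univ (fun i => |x i|)
      (fun i => ‖L (EuclideanSpace.single i 1)‖)
    simp only [sq_abs, hx2] at b
    have c := (pow_le_pow_left₀ (norm_nonneg _) a 2).trans b
    refine le_of_sq_le_sq ?_ (by positivity)
    rw [mul_pow, Real.sq_sqrt hS0, mul_comm]
    exact c
  calc ‖L‖ ^ 2 ≤ (√S) ^ 2 := pow_le_pow_left₀ (norm_nonneg _) h 2
    _ = S := Real.sq_sqrt hS0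

set_option maxHeartbeats 2000000 in
lemma hess_norm {N : ℕ} {v : EuclideanSpace ℝ (Fin N) → ℂ}
    (hv : ContDiff ℝ (⊤ : ℕ∞) v) (hs : HasCompactSupport v) :
    ∫ x, ‖fderiv ℝ (fderiv ℝ v) x‖ ^ 2 ≤ ∫ x, ‖lap v x‖ ^ 2 := by
  have h : ContDiff ℝ (⊤ : ℕ∞) (fderiv ℝ v) := hv.fderiv_right (by simp)
  have h2 : ContDiff ℝ (⊤ : ℕ∞) (fderiv ℝ (fderiv ℝ v)) := h.fderiv_right (by simp)
  have key : ∀ (i j : Fin N) x, pdv i (pdv j v) x =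
      fderiv ℝ (fderiv ℝ v) x (EuclideanSpace.single i 1) (EuclideanSpace.single j 1) := by
    intro i j x
    have hd : DifferentiableAt ℝ (fderiv ℝ v) x := (h.differentiable (by simp)) x
    unfold pdv
    rw [fderiv_clm_apply hd (differentiableAt_const _)]
    simp
  have hI : ∀ i j, Integrable fun x => ‖pdv j (pdv i v) x‖ ^ 2 := fun i j =>
    int_sq (pdv_smooth _ (pdv_smooth _ hv)).continuous (pdv_supp _ (pdv_supp _ hs))
  have hJ : ∀ j, Integrable fun x => ∑ i, ‖pdv j (pdv i v) x‖ ^ 2 := fun j =>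
    integrable_finsetSum Finset.univ (fun i _ => hI i j)
  have hK : Integrable fun x => ∑ j, ∑ i, ‖pdv j (pdv i v) x‖ ^ 2 :=
    integrable_finsetSum Finset.univ (fun j _ => hJ j)
  have hL : Integrable fun x => ‖fderiv ℝ (fderiv ℝ v) x‖ ^ 2 :=
    int_sq h2.continuous ((hs.fderiv ℝ).fderiv ℝ)
  have hpt : ∀ x, ‖fderiv ℝ (fderiv ℝ v) x‖ ^ 2 ≤ ∑ j, ∑ i, ‖pdv j (pdv i v) x‖ ^ 2 := by
    intro x
    refine (clm_norm_sq_le _).trans (Finset.sum_le_sum fun j _ => ?_)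
    refine (clm_norm_sq_le _).trans (Finset.sum_le_sum fun i _ => ?_)
    rw [key]
  have e : ∫ x, ∑ j, ∑ i, ‖pdv j (pdv i v) x‖ ^ 2 =
      ∑ j, ∑ i, ∫ x, ‖pdv j (pdv i v) x‖ ^ 2 := by
    rw [integral_finsetSum Finset.univ (fun j _ => hJ j)]
    refine Finset.sum_congr rfl fun j _ => ?_
    rw [integral_finsetSum Finset.univ (fun i _ => hI i j)]
  rw [← hess_eq hv hs, Finset.sum_comm, ← e]
  exact integral_mono hL hK hpt

open scoped ENNReal NNReal

lemma eLpNorm_two_eq {N : ℕ} {F : Type*} [NormedAddCommGroup F] [NormedSpace ℝ F]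
    {u : EuclideanSpace ℝ (Fin N) → F} (hu : Continuous u)
    (hs : HasCompactSupport u) :
    eLpNorm u 2 volume = ENNReal.ofReal ((∫ x, ‖u x‖ ^ 2) ^ ((1 : ℝ) / 2)) := by
  have hI := int_sq hu hs
  have h0 : 0 ≤ ∫ x, ‖u x‖ ^ 2 := integral_nonneg fun x => by positivity
  rw [eLpNorm_eq_lintegral_rpow_enorm_toReal (by simp) (by simp),
    ← ENNReal.ofReal_rpow_of_nonneg h0 (by norm_num),
    ofReal_integral_eq_lintegral_ofReal hI (Filter.Eventually.of_forall fun x => by positivity)]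
  simp only [ENNReal.toReal_ofNat]
  congr 1
  refine lintegral_congr fun x => ?_
  rw [ENNReal.ofReal_pow (norm_nonneg _), ofReal_norm]
  simp

/-- Second order Sobolev inequality. -/
lemma sobolev2 (N : ℕ) (hN : 5 ≤ N) : ∃ K : ℝ, 0 < K ∧ ∀ v : EuclideanSpace ℝ (Fin N) → ℂ,
    ContDiff ℝ (⊤ : ℕ∞) v → HasCompactSupport v →
    ∫⁻ x, ‖v x‖ₑ ^ (2 * (N : ℝ) / (N - 4)) ≤
      ENNReal.ofReal (K * (∫ x, ‖lap v x‖ ^ 2) ^ ((N : ℝ) / (N - 4))) := by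
  have hN' : (5 : ℝ) ≤ N := by exact_mod_cast hN
  have h2 : (0 : ℝ) < N - 2 := by linarith
  have h4 : (0 : ℝ) < N - 4 := by linarith
  obtain ⟨p1, hp1⟩ : ∃ p : ℝ≥0, (p : ℝ) = 2 * N / (N - 2) := ⟨⟨2 * N / (N - 2), by positivity⟩, rfl⟩
  obtain ⟨p2, hp2⟩ : ∃ p : ℝ≥0, (p : ℝ) = 2 * N / (N - 4) := ⟨⟨2 * N / (N - 4), by positivity⟩, rfl⟩
  have hp2pos : (0 : ℝ) < p2 := by rw [hp2]; positivity
  set E := EuclideanSpace ℝ (Fin N)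
  set C1 : ℝ≥0 := SNormLESNormFDerivOfEqConst ℂ (volume : Measure E) p1
  set C2 : ℝ≥0 := SNormLESNormFDerivOfEqConst (E →L[ℝ] ℂ) (volume : Measure E) 2
  refine ⟨((C1 * C2 : ℝ≥0) : ℝ) ^ (p2 : ℝ) + 1, by positivity, fun v hv hs => ?_⟩
  have h : ContDiff ℝ (⊤ : ℕ∞) (fderiv ℝ v) := hv.fderiv_right (by simp)
  have hh : ContDiff ℝ (⊤ : ℕ∞) (fderiv ℝ (fderiv ℝ v)) := h.fderiv_right (by simp)
  have s1 := eLpNorm_le_eLpNorm_fderiv_of_eq (μ := (volume : Measure E)) (p := p1) (p' := p2)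
    (hv.of_le (by exact_mod_cast le_top)) hs
    (by rw [← NNReal.coe_le_coe, hp1, NNReal.coe_one, one_le_div h2]; linarith) (by simp [E]; omega)
    (by rw [NNReal.coe_inv, hp1, hp2]; simp only [E, finrank_euclideanSpace, Fintype.card_fin]; field_simp; ring)
  have s2 := eLpNorm_le_eLpNorm_fderiv_of_eq (μ := (volume : Measure E)) (p := 2) (p' := p1)
    (h.of_le (by exact_mod_cast le_top)) (hs.fderiv ℝ) (by norm_num) (by simp [E]; omega)
    (by rw [hp1]; simp only [E, finrank_euclideanSpace, Fintype.card_fin]; push_cast; field_simp)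
  have s3 : eLpNorm (fderiv ℝ (fderiv ℝ v)) 2 volume ≤
      ENNReal.ofReal ((∫ x, ‖lap v x‖ ^ 2) ^ ((1 : ℝ) / 2)) := by
    rw [eLpNorm_two_eq hh.continuous ((hs.fderiv ℝ).fderiv ℝ)]
    refine ENNReal.ofReal_le_ofReal (Real.rpow_le_rpow ?_ (hess_norm hv hs) (by norm_num))
    exact integral_nonneg fun x => by positivity
  set I := ∫ x, ‖lap v x‖ ^ 2 with hI
  have hI0 : 0 ≤ I := integral_nonneg fun x => by positivity
  have s4 : eLpNorm v p2 volume ≤ ENNReal.ofReal (((C1 * C2 : ℝ≥0) : ℝ) * I ^ ((1 : ℝ) / 2)) := by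
    rw [ENNReal.ofReal_mul (by positivity), ENNReal.ofReal_coe_nnreal, ENNReal.coe_mul, mul_assoc]
    refine s1.trans (mul_le_mul_right (s2.trans (mul_le_mul_right s3 _)) _)
  have s5 := ENNReal.rpow_le_rpow s4 hp2pos.le
  have hp2' : p2 ≠ 0 := by rintro rfl; simp at hp2pos
  rw [eLpNorm_nnreal_pow_eq_lintegral hp2', hp2,
    ENNReal.ofReal_rpow_of_nonneg (by positivity) (by positivity)] at s5
  refine s5.trans (ENNReal.ofReal_le_ofReal ?_)
  rw [Real.mul_rpow (by positivity) (by positivity), ← Real.rpow_mul hI0, hp2]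
  have : (1 : ℝ) / 2 * (2 * N / (N - 4)) = N / (N - 4) := by ring
  rw [this]
  refine mul_le_mul_of_nonneg_right (by linarith) (by positivity)

/-- Rellich inequality. -/
lemma rellich {N : ℕ} (hN : 5 ≤ N) {v : EuclideanSpace ℝ (Fin N) → ℂ}
    (hv : ContDiff ℝ (⊤ : ℕ∞) v) (hs : HasCompactSupport v) :
    ∫⁻ x, ENNReal.ofReal (‖x‖ ^ (-4 : ℝ) * ‖v x‖ ^ 2) ≤ ENNReal.ofReal
      ((2 / ((N : ℝ) - 4)) ^ 2 * (2 / ((N : ℝ) - 2)) ^ 2 * ∫ x, ‖lap v x‖ ^ 2) := by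
  set R := (2 / ((N : ℝ) - 4)) ^ 2 * (2 / ((N : ℝ) - 2)) ^ 2 * ∫ x, ‖lap v x‖ ^ 2
  set e : ℕ → ℝ := fun n => 1 / ((n : ℝ) + 1)
  have he : ∀ n, 0 < e n := fun n => by positivity
  have het : Filter.Tendsto e Filter.atTop (nhds 0) := tendsto_one_div_add_atTop_nhds_zero_nat
  have h1 : ∀ n, ∫⁻ x, ENNReal.ofReal (wt (e n) 2 x * ‖v x‖ ^ 2) ≤ ENNReal.ofReal R := by
    intro n
    rw [← ofReal_integral_eq_lintegral_ofReal (int_mul_sq hv.continuous hs (wt_cont (he n) 2))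
      (Filter.Eventually.of_forall fun x => by
        have := he n
        simp only [wt, Pi.zero_apply]; positivity)]
    exact ENNReal.ofReal_le_ofReal (rellich_eps hN (he n) hv hs)
  have hlim : ∀ x : EuclideanSpace ℝ (Fin N), ENNReal.ofReal (‖x‖ ^ (-4 : ℝ) * ‖v x‖ ^ 2) ≤
      Filter.liminf (fun n => ENNReal.ofReal (wt (e n) 2 x * ‖v x‖ ^ 2)) Filter.atTop := by
    intro x
    by_cases hx : x = 0
    · subst hx
      simp
    · have hx' : 0 < ‖x‖ := norm_pos_iff.2 hx
      have ht : Filter.Tendsto (fun n => ENNReal.ofReal (wt (e n) 2 x * ‖v x‖ ^ 2)) Filter.atTop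
          (nhds (ENNReal.ofReal (((‖x‖ ^ 2 + 0) ^ 2)⁻¹ * ‖v x‖ ^ 2))) := by
        refine (ENNReal.continuous_ofReal.tendsto _).comp ?_
        refine Filter.Tendsto.mul_const _ ?_
        exact (((tendsto_const_nhds.add het).pow 2).inv₀ (by positivity))
      rw [ht.liminf_eq]
      refine le_of_eq ?_
      congr 2
      rw [Real.rpow_neg hx'.le, add_zero, ← pow_mul]
      congr 1
      exact_mod_cast Real.rpow_natCast ‖x‖ 4
  calc _ ≤ ∫⁻ x, Filter.liminf (fun n => ENNReal.ofReal (wt (e n) 2 x * ‖v x‖ ^ 2)) Filter.atTop :=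
        lintegral_mono hlim
    _ ≤ Filter.liminf (fun n => ∫⁻ x, ENNReal.ofReal (wt (e n) 2 x * ‖v x‖ ^ 2)) Filter.atTop := by
        refine lintegral_liminf_le fun n => ?_
        have := hv.continuous
        have := wt_cont (N := N) (he n) 2
        exact (ENNReal.continuous_ofReal.comp (by fun_prop)).measurable
    _ ≤ ENNReal.ofReal R := by
        refine Filter.liminf_le_of_le (by isBoundedDefault) fun b hb => ?_
        obtain ⟨n, hn⟩ := hb.exists
        exact hn.trans (h1 n)

/-- **Gagliardo–Nirenberg inequality for the inhomogeneous local nonlinearity,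
bi-harmonic case.** -/
theorem gn_local_biharmonic (N : ℕ) (hN : 5 ≤ N) (τ q B' A' : ℝ)
    (hτ0 : 0 < τ) (hτ1 : τ < 2)
    (hq1 : 1 < q) (hq2 : q < 1 + (4 - 2 * τ) / ((N : ℝ) - 4))
    (hB : B' = (N * q - N + 2 * τ) / 2) (hA : A' = 2 * q - B') :
    ∃ C > 0, ∀ v : EuclideanSpace ℝ (Fin N) → ℂ,
      ContDiff ℝ (⊤ : ℕ∞) v → HasCompactSupport v →
      potQ τ q v ≤ C * l2norm v ^ A' * l2norm (lap v) ^ B' := by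
  have hN' : (5 : ℝ) ≤ N := by exact_mod_cast hN
  have h2 : (0 : ℝ) < N - 2 := by linarith
  have h4 : (0 : ℝ) < N - 4 := by linarith
  obtain ⟨K, hK, hSob⟩ := sobolev2 N hN
  set K1 := (2 / ((N : ℝ) - 4)) ^ 2 * (2 / ((N : ℝ) - 2)) ^ 2 with hK1
  have hK1pos : 0 < K1 := by positivity
  set a := τ / 2 with ha
  set c := (q - 1) * (N - 4) / 4 with hc
  set b := 1 - a - c with hb
  have hapos : 0 < a := by positivity
  have hcpos : 0 < c := by
    have : 0 < q - 1 := by linarith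
    positivity
  have hbpos : 0 < b := by
    have h : q - 1 < (4 - 2 * τ) / (N - 4) := by linarith
    rw [lt_div_iff₀ h4] at h
    rw [hb, ha, hc]; linarith
  set p := 2 * (N : ℝ) / (N - 4) with hp
  have hppos : 0 < p := by positivity
  refine ⟨K1 ^ a * K ^ c, by positivity, fun v hv hs => ?_⟩
  have hcont := hv.continuous
  set P := ∫ x, ‖v x‖ ^ 2 with hP
  set L := ∫ x, ‖lap v x‖ ^ 2 with hL
  have hP0 : 0 ≤ P := integral_nonneg fun x => by positivity
  have hL0 : 0 ≤ L := integral_nonneg fun x => by positivity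
  have r1 := rellich hN hv hs
  have r2 : ∫⁻ x, ENNReal.ofReal (‖v x‖ ^ 2) = ENNReal.ofReal P :=
    (ofReal_integral_eq_lintegral_ofReal (int_sq hcont hs)
      (Filter.Eventually.of_forall fun x => by positivity)).symm
  have r3 := hSob v hv hs
  have hpt : ∀ x, ENNReal.ofReal (‖x‖ ^ (-(2 * τ)) * ‖v x‖ ^ (2 * q)) =
      ∏ i : Fin 3, ((![fun x => ENNReal.ofReal (‖x‖ ^ (-4 : ℝ) * ‖v x‖ ^ 2),
        fun x => ENNReal.ofReal (‖v x‖ ^ 2), fun x => ‖v x‖ₑ ^ p] :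
          Fin 3 → EuclideanSpace ℝ (Fin N) → ℝ≥0∞) i x) ^ ((![a, b, c] : Fin 3 → ℝ) i) := by
    intro x
    have hv0 := norm_nonneg (v x)
    have hx0 := norm_nonneg x
    rw [Fin.prod_univ_three]
    simp only [Matrix.cons_val_zero, Matrix.cons_val_one, Matrix.cons_val]
    rw [← ofReal_norm (v x), ENNReal.ofReal_rpow_of_nonneg hv0 hppos.le,
      ENNReal.ofReal_rpow_of_nonneg (by positivity) hapos.le,
      ENNReal.ofReal_rpow_of_nonneg (by positivity) hbpos.le,
      ENNReal.ofReal_rpow_of_nonneg (by positivity) hcpos.le,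
      ← ENNReal.ofReal_mul (by positivity), ← ENNReal.ofReal_mul (by positivity)]
    congr 1
    rw [Real.mul_rpow (by positivity) (by positivity), ← Real.rpow_mul hx0, ← Real.rpow_natCast,
      ← Real.rpow_mul hv0, ← Real.rpow_mul hv0, ← Real.rpow_mul hv0, mul_assoc, mul_assoc,
      ← Real.rpow_add_of_nonneg hv0 (by positivity) (by positivity),
      ← Real.rpow_add_of_nonneg hv0 (by positivity) (by positivity)]
    congr 2
    · rw [ha]; ring
    · rw [hb, hc, hp, ha]; push_cast; field_simp; ring
  have hold := ENNReal.lintegral_prod_norm_pow_le (μ := (volume : Measure (EuclideanSpace ℝ (Fin N))))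
    (Finset.univ : Finset (Fin 3))
    (f := ![fun x => ENNReal.ofReal (‖x‖ ^ (-4 : ℝ) * ‖v x‖ ^ 2),
        fun x => ENNReal.ofReal (‖v x‖ ^ 2), fun x => ‖v x‖ₑ ^ p])
    (p := ![a, b, c])
    (by
      have hm : Measurable v := hcont.measurable
      intro i _
      fin_cases i
      · simp; fun_prop
      · simp; fun_prop
      · simp; fun_prop)
    (by simp [Fin.sum_univ_three, hb]; ring)
    (by
      intro i _
      fin_cases i
      · exact hapos.le
      · exact hbpos.le
      · exact hcpos.le)
  simp_rw [← hpt] at hold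
  rw [Fin.prod_univ_three] at hold
  simp only [Matrix.cons_val_zero, Matrix.cons_val_one, Matrix.cons_val] at hold
  have hfin : ∫⁻ x, ENNReal.ofReal (‖x‖ ^ (-(2 * τ)) * ‖v x‖ ^ (2 * q)) ≤
      ENNReal.ofReal ((K1 * L) ^ a * P ^ b * (K * L ^ ((N : ℝ) / (N - 4))) ^ c) := by
    rw [ENNReal.ofReal_mul (by positivity), ENNReal.ofReal_mul (by positivity),
      ← ENNReal.ofReal_rpow_of_nonneg (by positivity) hapos.le,
      ← ENNReal.ofReal_rpow_of_nonneg (by positivity) hbpos.le,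
      ← ENNReal.ofReal_rpow_of_nonneg (by positivity) hcpos.le, ← r2]
    exact hold.trans (mul_le_mul' (mul_le_mul' (ENNReal.rpow_le_rpow r1 hapos.le) le_rfl)
      (ENNReal.rpow_le_rpow r3 hcpos.le))
  have hmeas : AEStronglyMeasurable
      (fun x : EuclideanSpace ℝ (Fin N) => ‖x‖ ^ (-(2 * τ)) * ‖v x‖ ^ (2 * q)) volume := by
    have hm : Measurable v := hcont.measurable
    exact Measurable.aestronglyMeasurable (by fun_prop)
  have hQ : potQ τ q v ≤ (K1 * L) ^ a * P ^ b * (K * L ^ ((N : ℝ) / (N - 4))) ^ c := by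
    unfold potQ
    rw [integral_eq_lintegral_of_nonneg_ae (Filter.Eventually.of_forall fun x => by
      simp only [Pi.zero_apply]; positivity) hmeas]
    exact ENNReal.toReal_le_of_le_ofReal (by positivity) hfin
  refine hQ.trans (le_of_eq ?_)
  unfold l2norm
  rw [← hP, ← hL, Real.mul_rpow hK1pos.le hL0, Real.mul_rpow hK.le (by positivity),
    ← Real.rpow_mul hL0, ← Real.rpow_mul hP0, ← Real.rpow_mul hL0]
  have e1 : 1 / 2 * A' = b := by rw [hA, hB, hb, ha, hc]; ring
  have e2 : 1 / 2 * B' = a + (N : ℝ) / (N - 4) * c := by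
    rw [hB, ha, hc]; field_simp; ring
  rw [e1, e2, Real.rpow_add_of_nonneg hL0 hapos.le (by positivity)]
  ring
end
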